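/- Fix β ∈ ℝ and for each n ≥ 1 let τ_n = τ_n^{β,321} be a Mallows random permutation with parameter e^{β/n} conditioned to avoid 321. Then the pairs of measures (π₁^{τ_n}, π₂^{τ_n}) satisfy a large deviation principle on D at speed n with rate function (π₁,π₂) ↦ A_β(π₁,π₂) − inf_D A_β, where A_β(π₁,π₂) := H^{321}(π₁,π₂) − β·∫₀¹ x·(ρ₁(x) − ρ₂(x)) dx, H^{321}(π₁,π₂) := ∫₀¹ [ρ₁ log ρ₁ + (1−ρ₁) log(1−ρ₁) + ρ₂ log ρ₂ + (1−ρ₂) log(1−ρ₂) + 2 log 2] dLeb (with 0·log 0 = 0), and ρ₁, ρ₂ are the Lebesgue densities of π₁ and π₂. -/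

import Mathlib

open MeasureTheory Filter Set

attribute [local instance] Classical.propDecidable

noncomputable section

/-- Number of inversions of a permutation of `Fin n`. -/
def invCount {n : ℕ} (σ : Equiv.Perm (Fin n)) : ℕ :=
  (Finset.univ.filter (fun p : Fin n × Fin n => p.1 < p.2 ∧ σ p.2 < σ p.1)).card

/-- `σ` avoids the pattern `321`. -/
def Avoids321 {n : ℕ} (σ : Equiv.Perm (Fin n)) : Prop :=
  ¬ ∃ i j k : Fin n, i < j ∧ j < k ∧ σ j < σ i ∧ σ k < σ j

/-- Partition function of the 321-avoiding Mallows model with parameter `e^{β/n}`. -/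
def Z321 (β : ℝ) (n : ℕ) : ℝ :=
  ∑ σ ∈ Finset.univ.filter (fun σ : Equiv.Perm (Fin n) => Avoids321 σ),
    Real.exp (β / n * invCount σ)

/-- `(a, σ a)` is a strict right-to-left minimum of `σ`. -/
def IsStrictRLMin {n : ℕ} (σ : Equiv.Perm (Fin n)) (a : Fin n) : Prop :=
  σ a < a ∧ ∀ c : Fin n, a < c → σ a < σ c

/-- The set of positions of strict right-to-left minima of `σ`. -/
def RLMpositions {n : ℕ} (σ : Equiv.Perm (Fin n)) : Finset (Fin n) :=
  Finset.univ.filter (fun a => IsStrictRLMin σ a)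

/-- The measure `π₁^σ`. -/
def pi1 {n : ℕ} (σ : Equiv.Perm (Fin n)) : Measure ℝ :=
  ∑ a ∈ RLMpositions σ,
    volume.restrict (Set.Icc (((a : ℕ) : ℝ) / n) ((((a : ℕ) : ℝ) + 1) / n))

/-- The measure `π₂^σ`. -/
def pi2 {n : ℕ} (σ : Equiv.Perm (Fin n)) : Measure ℝ :=
  ∑ a ∈ RLMpositions σ,
    volume.restrict
      (Set.Icc ((((σ a : Fin n) : ℕ) : ℝ) / n) (((((σ a : Fin n) : ℕ) : ℝ) + 1) / n))

/-- Lebesgue measure on `[0,1]`. -/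
def Leb01 : Measure ℝ := volume.restrict (Set.Icc (0:ℝ) 1)

/-- The defining property of the space `D`. -/
def MemD (π₁ π₂ : Measure ℝ) : Prop :=
  π₁ ≤ Leb01 ∧ π₂ ≤ Leb01 ∧ π₁ Set.univ = π₂ Set.univ ∧
    ∀ x : ℝ, π₁ (Set.Icc 0 x) ≤ π₂ (Set.Icc 0 x)

/-- The space `D`, with the topology of weak convergence. -/
def Dspace : Type :=
  {p : FiniteMeasure ℝ × FiniteMeasure ℝ //
    MemD (p.1 : Measure ℝ) (p.2 : Measure ℝ)}

instance : TopologicalSpace Dspace := by unfold Dspace; infer_instance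

/-- The Lebesgue density of a (subuniform) measure on `[0,1]`. -/
def dens (π : FiniteMeasure ℝ) (x : ℝ) : ℝ :=
  ((π : Measure ℝ).rnDeriv volume x).toReal

/-- Entropy-type integrand: `ρ log ρ + (1−ρ) log(1−ρ) + log 2` (with `0 log 0 = 0`). -/
def entTerm (r : ℝ) : ℝ :=
  r * Real.log r + (1 - r) * Real.log (1 - r) + Real.log 2

/-- The rate function `H^{321}`. -/
def H321 (p : Dspace) : ℝ :=
  ∫ x in Set.Icc (0:ℝ) 1, (entTerm (dens p.1.1 x) + entTerm (dens p.1.2 x))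

/-- The action `A_β(π₁,π₂) = H^{321}(π₁,π₂) − β ∫₀¹ x (ρ₁(x) − ρ₂(x)) dx`. -/
def A321 (β : ℝ) (p : Dspace) : ℝ :=
  H321 p - β * ∫ x in Set.Icc (0:ℝ) 1, x * (dens p.1.1 x - dens p.1.2 x)

/-- A sequence of set functions `p n` (probabilities of events) satisfies a large
deviation principle at speed `n` with rate function `I` (a nonnegative lower
semicontinuous function with values in `[0,∞]`). -/
def SatisfiesLDP {X : Type*} [TopologicalSpace X]
    (p : ℕ → Set X → ENNReal) (I : X → EReal) : Prop :=
  LowerSemicontinuous I ∧ (∀ x, 0 ≤ I x) ∧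
  (∀ F : Set X, IsClosed F →
    Filter.limsup (fun n : ℕ => (((n : ℝ)⁻¹ : ℝ) : EReal) * ENNReal.log (p n F))
      Filter.atTop ≤ - ⨅ x ∈ F, I x) ∧
  (∀ O : Set X, IsOpen O →
    - ⨅ x ∈ O, I x ≤
      Filter.liminf (fun n : ℕ => (((n : ℝ)⁻¹ : ℝ) : EReal) * ENNReal.log (p n O))
        Filter.atTop)

/-- Probability that the Mallows random permutation of size `n` with parameter
`e^{β/n}`, conditioned to avoid `321`, has its pair of RLM occupation measures
in `S`. -/
def probMallows321 (β : ℝ) (Pi : ∀ n : ℕ, Equiv.Perm (Fin n) → Dspace) (n : ℕ)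
    (S : Set Dspace) : ENNReal :=
  (∑ σ ∈ Finset.univ.filter
      (fun σ : Equiv.Perm (Fin n) => Avoids321 σ ∧ Pi n σ ∈ S),
    ENNReal.ofReal (Real.exp (β / n * invCount σ))) / ENNReal.ofReal (Z321 β n)

section Combinatorics

variable {n : ℕ}

lemma Avoids321.isStrictRLMin_of_inversion {σ : Equiv.Perm (Fin n)} (h : Avoids321 σ)
    {i j : Fin n} (hij : i < j) (hσ : σ j < σ i) : IsStrictRLMin σ j := by
  have h2 : ∀ c, j < c → σ j < σ c := by
    intro c hc
    by_contra hcon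
    have : σ c < σ j := lt_of_le_of_ne (not_lt.1 hcon) (fun e => hc.ne' (σ.injective e))
    exact h ⟨i, j, c, hij, hc, hσ, this⟩
  refine ⟨?_, h2⟩
  have hsub : (Finset.Iio (σ j)).map σ.symm.toEmbedding ⊆ (Finset.Iio j).erase i := by
    intro x hx
    simp only [Finset.mem_map, Finset.mem_Iio, Equiv.coe_toEmbedding] at hx
    obtain ⟨y, hy, rfl⟩ := hx
    simp only [Finset.mem_erase, Finset.mem_Iio]
    constructor
    · rintro rfl
      rw [Equiv.apply_symm_apply] at hσ
      exact absurd hy (not_lt.2 hσ.le)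
    · by_contra hcon
      rcases (not_lt.1 hcon).eq_or_lt with e | e
      · rw [e] at hy; simp at hy
      · have := h2 _ e
        rw [Equiv.apply_symm_apply] at this
        exact absurd hy (not_lt.2 this.le)
  have hc := Finset.card_le_card hsub
  rw [Finset.card_map, Finset.card_erase_of_mem (by simpa using hij), Fin.card_Iio,
    Fin.card_Iio] at hc
  have : (i : ℕ) < j := hij
  show (σ j : ℕ) < j
  omega

lemma strictMonoOn_RLMpositions (σ : Equiv.Perm (Fin n)) :
    StrictMonoOn σ (RLMpositions σ : Set (Fin n)) := by
  intro i hi j hj hij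
  simp only [RLMpositions, Finset.coe_filter, Finset.mem_univ, true_and, Set.mem_ofPred_eq] at hi
  exact hi.2 _ hij

lemma Avoids321.strictMonoOn_compl {σ : Equiv.Perm (Fin n)} (h : Avoids321 σ) :
    StrictMonoOn σ ((RLMpositions σ : Set (Fin n))ᶜ) := by
  intro i hi j hj hij
  by_contra hcon
  have : σ j < σ i := lt_of_le_of_ne (not_lt.1 hcon) (fun e => hij.ne' (σ.injective e))
  have := h.isStrictRLMin_of_inversion hij this
  simp [RLMpositions] at hj
  exact hj this

/-- The number of inversions ending at a strict right-to-left minimum `j` is `j - σ j`. -/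
lemma IsStrictRLMin.card_inversions {σ : Equiv.Perm (Fin n)} {j : Fin n}
    (h : IsStrictRLMin σ j) :
    (Finset.univ.filter (fun i : Fin n => i < j ∧ σ j < σ i)).card + σ j = j := by
  have h1 : (Finset.univ.filter (fun i : Fin n => i < j ∧ σ j < σ i)) ∪
      (Finset.Iio (σ j)).map σ.symm.toEmbedding = Finset.Iio j := by
    ext x
    simp only [Finset.mem_union, Finset.mem_filter, Finset.mem_univ, true_and, Finset.mem_map_equiv,
      Equiv.symm_symm, Finset.mem_Iio]
    constructor
    · rintro (hx | hx)
      · exact hx.1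
      · by_contra hcon
        rcases (not_lt.1 hcon).eq_or_lt with e | e
        · rw [e] at hx; simp at hx
        · exact absurd hx (not_lt.2 (h.2 _ e).le)
    · intro hx
      rcases lt_trichotomy (σ x) (σ j) with e | e | e
      · exact Or.inr e
      · exact absurd (σ.injective e) hx.ne
      · exact Or.inl ⟨hx, e⟩
  have hd : Disjoint (Finset.univ.filter (fun i : Fin n => i < j ∧ σ j < σ i))
      ((Finset.Iio (σ j)).map σ.symm.toEmbedding) := by
    rw [Finset.disjoint_left]
    intro x hx hx2
    simp only [Finset.mem_filter, Finset.mem_univ, true_and, Finset.mem_map_equiv,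
      Equiv.symm_symm, Finset.mem_Iio] at hx hx2
    exact absurd hx2 (not_lt.2 hx.2.le)
  have := congrArg Finset.card h1
  rw [Finset.card_union_of_disjoint hd, Finset.card_map, Fin.card_Iio, Fin.card_Iio] at this
  exact this

/-- For a permutation avoiding `321`, the number of inversions is a linear statistic of the
strict right-to-left minima. -/
lemma Avoids321.invCount_add_sum {σ : Equiv.Perm (Fin n)} (h : Avoids321 σ) :
    invCount σ + ∑ a ∈ RLMpositions σ, (σ a : ℕ) = ∑ a ∈ RLMpositions σ, (a : ℕ) := by
  have h1 : invCount σ = ∑ j ∈ RLMpositions σ,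
      (Finset.univ.filter (fun i : Fin n => i < j ∧ σ j < σ i)).card := by
    have h2 : invCount σ = ∑ j : Fin n,
        (Finset.univ.filter (fun i : Fin n => i < j ∧ σ j < σ i)).card := by
      unfold invCount
      rw [Finset.card_eq_sum_card_fiberwise (f := Prod.snd) (t := Finset.univ) (by simp)]
      refine Finset.sum_congr rfl fun j _ => ?_
      refine Finset.card_bij' (fun p _ => p.1) (fun i _ => (i, j)) ?_ ?_ ?_ ?_
      · rintro ⟨a, b⟩ hp
        simp only [Finset.mem_filter, Finset.mem_univ, true_and] at hp ⊢
        obtain ⟨hp, rfl⟩ := hp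
        exact hp
      · intro i hi
        simpa using hi
      · rintro ⟨a, b⟩ hp
        simp only [Finset.mem_filter, Finset.mem_univ, true_and] at hp
        rw [hp.2]
      · intro i hi; rfl
    rw [h2]
    symm
    apply Finset.sum_subset (Finset.subset_univ _)
    intro j _ hj
    rw [Finset.card_eq_zero, Finset.filter_eq_empty_iff]
    rintro i - ⟨hij, hσ⟩
    exact hj (by simpa [RLMpositions] using h.isStrictRLMin_of_inversion hij hσ)
  rw [h1, ← Finset.sum_add_distrib]
  refine Finset.sum_congr rfl fun j hj => ?_
  exact IsStrictRLMin.card_inversions (by simpa [RLMpositions] using hj)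

/-- Two permutations which agree as sets on a block on which both increase agree there. -/
lemma eqOn_of_strictMonoOn_of_image_eq {α : Type*} [LinearOrder α] [WellFoundedLT α]
    {f g : α → α} {s : Set α} (hf : StrictMonoOn f s)
    (hg : StrictMonoOn g s) (h : f '' s = g '' s) : EqOn f g s := by
  have := (StrictMono.range_inj (f := fun x : s => f x) (g := fun x : s => g x)
    (fun x y hxy => hf x.2 y.2 hxy) (fun x y hxy => hg x.2 y.2 hxy)).1 (by
      rw [← image_eq_range, ← image_eq_range, h])
  intro x hx
  exact congrFun this ⟨x, hx⟩

/-- A `321`-avoiding permutation is determined by the positions and values of its strict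
right-to-left minima. -/
lemma Avoids321.ext {σ τ : Equiv.Perm (Fin n)} (hσ : Avoids321 σ) (hτ : Avoids321 τ)
    (h1 : RLMpositions σ = RLMpositions τ)
    (h2 : (RLMpositions σ).image σ = (RLMpositions τ).image τ) : σ = τ := by
  have h2' : σ '' (RLMpositions σ : Set (Fin n)) = τ '' (RLMpositions τ : Set (Fin n)) := by
    have := congrArg (fun s : Finset (Fin n) => (s : Set (Fin n))) h2
    simpa using this
  have hA : EqOn σ τ (RLMpositions σ : Set (Fin n)) := by
    apply eqOn_of_strictMonoOn_of_image_eq (strictMonoOn_RLMpositions σ)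
    · rw [h1]; exact strictMonoOn_RLMpositions τ
    · rw [h2', h1]
  have hB : EqOn σ τ ((RLMpositions σ : Set (Fin n))ᶜ) := by
    apply eqOn_of_strictMonoOn_of_image_eq hσ.strictMonoOn_compl
    · rw [h1]; exact hτ.strictMonoOn_compl
    · rw [image_compl_eq σ.bijective, image_compl_eq τ.bijective, h2', h1]
  ext x
  by_cases hx : x ∈ (RLMpositions σ : Set (Fin n))
  · rw [hA hx]
  · rw [hB hx]

/-- The permutation mapping `A` onto `B` and `Aᶜ` onto `Bᶜ`, increasingly on both. -/
lemma exists_perm_strictMonoOn (A B : Finset (Fin n)) (hAB : A.card = B.card) :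
    ∃ σ : Equiv.Perm (Fin n), (∀ x, σ x ∈ B ↔ x ∈ A) ∧
      StrictMonoOn σ (A : Set (Fin n)) ∧ StrictMonoOn σ ((A : Set (Fin n))ᶜ) := by
  have hc : Aᶜ.card = Bᶜ.card := by rw [Finset.card_compl, Finset.card_compl, hAB]
  let e : A ≃o B := (A.orderIsoOfFin rfl).symm.trans (B.orderIsoOfFin hAB.symm)
  let f : (Aᶜ : Finset (Fin n)) ≃o (Bᶜ : Finset (Fin n)) :=
    (Aᶜ.orderIsoOfFin rfl).symm.trans (Bᶜ.orderIsoOfFin hc.symm)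
  let f' : {x // x ∉ A} ≃ {x // x ∉ B} :=
    ((Equiv.subtypeEquivRight (by simp)).trans f.toEquiv).trans
      (Equiv.subtypeEquivRight (by simp))
  let σ : Equiv.Perm (Fin n) := Equiv.subtypeCongr (p := (· ∈ A)) (q := (· ∈ B)) e.toEquiv f'
  have h1 : ∀ x (hx : x ∈ A), σ x = e ⟨x, hx⟩ := by
    intro x hx
    simp [σ, Equiv.subtypeCongr, Equiv.sumCompl_symm_apply_of_pos hx]
  have h2 : ∀ x (hx : x ∉ A), σ x = f ⟨x, by simpa using hx⟩ := by
    intro x hx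
    simp only [σ, Equiv.subtypeCongr, Equiv.trans_apply, Equiv.sumCompl_symm_apply_of_neg hx]
    rfl
  refine ⟨σ, ?_, ?_, ?_⟩
  · intro x
    by_cases hx : x ∈ A
    · simp [h1 x hx, hx]
    · have := (f ⟨x, by simpa using hx⟩).2
      rw [h2 x hx]
      simp only [hx, iff_false]
      exact Finset.mem_compl.1 this
  · intro x hx y hy hxy
    rw [h1 x hx, h1 y hy]
    exact e.strictMono (show (⟨x, hx⟩ : A) < ⟨y, hy⟩ from hxy)
  · intro x hx y hy hxy
    rw [h2 x hx, h2 y hy]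
    exact f.strictMono (show (⟨x, _⟩ : (Aᶜ : Finset (Fin n))) < ⟨y, _⟩ from hxy)

lemma card_filter_lt_eq {σ : Equiv.Perm (Fin n)} {s : Finset (Fin n)} {t : Finset (Fin n)}
    (hst : ∀ x, σ x ∈ t ↔ x ∈ s) (hσ : StrictMonoOn σ (s : Set (Fin n))) {a : Fin n}
    (ha : a ∈ s) : (s.filter (· < a)).card = (t.filter (· < σ a)).card := by
  have : t.filter (· < σ a) = (s.filter (· < a)).map σ.toEmbedding := by
    ext y
    obtain ⟨x, rfl⟩ := σ.surjective y
    simp only [Finset.mem_filter, hst, Finset.mem_map_equiv, Equiv.symm_apply_apply]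
    constructor
    · rintro ⟨hx, h⟩
      exact ⟨hx, (hσ.lt_iff_lt hx ha).1 h⟩
    · rintro ⟨hx, h⟩
      exact ⟨hx, (hσ.lt_iff_lt hx ha).2 h⟩
  rw [this, Finset.card_map]

/-- Every pair of sets satisfying the ballot condition is the pair of positions and values of the
strict right-to-left minima of some `321`-avoiding permutation. -/
lemma exists_avoids321 (A B : Finset (Fin n)) (hAB : A.card = B.card)
    (hlt : ∀ x : Fin n, (A.filter (· ≤ x)).card ≤ (B.filter (· < x)).card) :
    ∃ σ : Equiv.Perm (Fin n), Avoids321 σ ∧ RLMpositions σ = A ∧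
      (RLMpositions σ).image σ = B := by
  obtain ⟨σ, hmem, hA, hAc⟩ := exists_perm_strictMonoOn A B hAB
  have hlt' : ∀ x : Fin n, (A.filter (· < x)).card ≤ (B.filter (· < x)).card := fun x =>
    (Finset.card_le_card (fun y hy => by
      simp only [Finset.mem_filter] at hy ⊢; exact ⟨hy.1, hy.2.le⟩)).trans (hlt x)
  have h1 : ∀ a ∈ A, σ a < a := by
    intro a ha
    by_contra hcon
    have hcon := not_lt.1 hcon
    have e1 := card_filter_lt_eq hmem hA ha
    have e2 : (B.filter (· < a)).card ≤ (B.filter (· < σ a)).card :=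
      Finset.card_le_card (fun y hy => by
        simp only [Finset.mem_filter] at hy ⊢; exact ⟨hy.1, hy.2.trans_le hcon⟩)
    have e3 : (A.filter (· < a)).card < (A.filter (· ≤ a)).card := by
      apply Finset.card_lt_card
      rw [Finset.ssubset_iff_of_subset]
      · exact ⟨a, by simp [ha], by simp⟩
      · intro y hy
        simp only [Finset.mem_filter] at hy ⊢; exact ⟨hy.1, hy.2.le⟩
    have := hlt a
    omega
  have hcompl : ∀ (s : Finset (Fin n)) (x : Fin n),
      (s.filter (· < x)).card + (sᶜ.filter (· < x)).card = x := by
    intro s x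
    have := Finset.card_filter_add_card_filter_not (s := Finset.Iio x) (fun y => y ∈ s)
    rw [Fin.card_Iio] at this
    convert this using 3
    · ext y; simp [and_comm]
    · ext y; simp [and_comm]
  have h2 : ∀ c, c ∉ A → c ≤ σ c := by
    intro c hc
    by_contra hcon
    have hcon := not_le.1 hcon
    have e1 : (Aᶜ.filter (· < c)).card = (Bᶜ.filter (· < σ c)).card :=
      card_filter_lt_eq (fun x => by simp [hmem]) (by simpa using hAc) (by simpa using hc)
    have e3 : (Bᶜ.filter (· < σ c)).card < (Bᶜ.filter (· < c)).card := by
      apply Finset.card_lt_card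
      rw [Finset.ssubset_iff_of_subset]
      · exact ⟨σ c, by simp [hcon, hmem, hc], by simp⟩
      · intro y hy
        simp only [Finset.mem_filter] at hy ⊢; exact ⟨hy.1, hy.2.trans hcon⟩
    have := hlt' c
    have := hcompl A c
    have := hcompl B c
    omega
  have hpos : RLMpositions σ = A := by
    ext a
    simp only [RLMpositions, Finset.mem_filter, Finset.mem_univ, true_and]
    constructor
    · intro h
      by_contra hcon
      exact absurd h.1 (not_lt.2 (h2 a hcon))
    · intro ha
      refine ⟨h1 a ha, fun c hc => ?_⟩
      by_cases hcA : c ∈ A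
      · exact hA ha hcA hc
      · exact ((h1 a ha).trans hc).trans_le (h2 c hcA)
  refine ⟨σ, ?_, hpos, ?_⟩
  · rintro ⟨i, j, k, hij, hjk, h1, h2⟩
    have key : ∀ x y : Fin n, x < y → σ y < σ x → (x ∈ A ↔ y ∉ A) := by
      intro x y hxy hσ
      constructor
      · intro hx hy; exact absurd (hA hx hy hxy) (not_lt.2 hσ.le)
      · intro hy
        by_contra hx
        exact absurd (hAc hx hy hxy) (not_lt.2 hσ.le)
    have k1 := key i j hij h1
    have k2 := key j k hjk h2
    have k3 := key i k (hij.trans hjk) (h2.trans h1)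
    tauto
  · rw [hpos]
    ext y
    obtain ⟨x, rfl⟩ := σ.surjective y
    simp [hmem]

end Combinatorics

section Softplus

/-- The function `t ↦ log (1 + e^t)`, convex conjugate of `-binEntropy` on `[0,1]`. -/
def softplus (t : ℝ) : ℝ := Real.log (1 + Real.exp t)

lemma exp_softplus (t : ℝ) : Real.exp (softplus t) = 1 + Real.exp t :=
  Real.exp_log (by linarith [Real.exp_pos t])

@[fun_prop] lemma continuous_softplus : Continuous softplus := by
  unfold softplus
  exact Continuous.log (by fun_prop) (fun t => by linarith [Real.exp_pos t])

lemma mul_neg_log_add_log_le {s x : ℝ} (hs : 0 ≤ s) (hx : 0 < x) :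
    s * (Real.log x - Real.log s) ≤ x - s := by
  rcases hs.eq_or_lt with rfl | hs
  · simpa using hx.le
  · rw [← Real.log_div hx.ne' hs.ne']
    have := Real.log_le_sub_one_of_pos (div_pos hx hs)
    calc _ ≤ s * (x / s - 1) := mul_le_mul_of_nonneg_left this hs.le
      _ = x - s := by field_simp

lemma mul_add_binEntropy_le_softplus {s : ℝ} (h0 : 0 ≤ s) (h1 : s ≤ 1) (t : ℝ) :
    s * t + Real.binEntropy s ≤ softplus t := by
  have hZ : 0 < 1 + Real.exp t := by linarith [Real.exp_pos t]
  have e1 := mul_neg_log_add_log_le h0 (x := Real.exp t / (1 + Real.exp t))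
    (div_pos (Real.exp_pos t) hZ)
  have e2 := mul_neg_log_add_log_le (s := 1 - s) (by linarith) (x := 1 / (1 + Real.exp t))
    (div_pos one_pos hZ)
  rw [Real.log_div (Real.exp_pos t).ne' hZ.ne', Real.log_exp] at e1
  rw [Real.log_div one_ne_zero hZ.ne', Real.log_one] at e2
  have e3 : Real.exp t / (1 + Real.exp t) + 1 / (1 + Real.exp t) = 1 := by
    field_simp; ring
  rw [Real.binEntropy, Real.log_inv, Real.log_inv, softplus]
  nlinarith

/-- The Young inequality is an equality at `t = log c - log (1 - c)`, up to changing slopes. -/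
lemma softplus_log_sub_log {c : ℝ} (h0 : 0 < c) (h1 : c < 1) :
    softplus (Real.log c - Real.log (1 - c)) = - Real.log (1 - c) := by
  have h2 : 0 < 1 - c := by linarith
  rw [softplus, Real.exp_sub, Real.exp_log h0, Real.exp_log h2, ← Real.log_inv]
  congr 1
  field_simp
  ring

lemma exists_mul_add_binEntropy_eq_softplus (t : ℝ) :
    ∃ s : ℝ, 0 < s ∧ s < 1 ∧ s * t + Real.binEntropy s = softplus t := by
  have hZ : 0 < 1 + Real.exp t := by linarith [Real.exp_pos t]
  have h0 : 0 < Real.exp t / (1 + Real.exp t) := div_pos (Real.exp_pos t) hZ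
  have h1 : 1 - Real.exp t / (1 + Real.exp t) = 1 / (1 + Real.exp t) := by field_simp; ring
  have h2 : 0 < 1 / (1 + Real.exp t) := div_pos one_pos hZ
  refine ⟨_, h0, by linarith, ?_⟩
  rw [Real.binEntropy, h1, Real.log_inv, Real.log_inv, Real.log_div (Real.exp_pos t).ne' hZ.ne',
    Real.log_div one_ne_zero hZ.ne', Real.log_exp, Real.log_one, softplus]
  field_simp
  ring

lemma softplus_sub_le (t u : ℝ) : softplus t - softplus u ≤ |t - u| := by
  obtain ⟨s, h0, h1, hs⟩ := exists_mul_add_binEntropy_eq_softplus t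
  have := mul_add_binEntropy_le_softplus h0.le h1.le u
  have h3 : s * (t - u) ≤ |t - u| := by
    calc s * (t - u) ≤ s * |t - u| := mul_le_mul_of_nonneg_left (le_abs_self _) h0.le
      _ ≤ 1 * |t - u| := mul_le_mul_of_nonneg_right h1.le (abs_nonneg _)
      _ = _ := one_mul _
  linarith

/-- Jensen's inequality for `softplus` on a cell of length `1 / n`. -/
lemma softplus_mul_setIntegral_le {f : ℝ → ℝ} (hf : Continuous f) {x n : ℝ} (hn : 0 < n) :
    softplus (n * ∫ y in Icc (x / n) ((x + 1) / n), f y) ≤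
      n * ∫ y in Icc (x / n) ((x + 1) / n), softplus (f y) := by
  set I := Icc (x / n) ((x + 1) / n)
  obtain ⟨s, h0, h1, hs⟩ := exists_mul_add_binEntropy_eq_softplus (n * ∫ y in I, f y)
  have hv : volume.real I = 1 / n := by
    rw [Real.volume_real_Icc_of_le (by gcongr; linarith)]
    ring
  have hi1 : IntegrableOn f I := hf.continuousOn.integrableOn_compact isCompact_Icc
  have hi2 : IntegrableOn (fun y => softplus (f y)) I :=
    (continuous_softplus.comp hf).continuousOn.integrableOn_compact isCompact_Icc
  have key : ∫ y in I, (s * f y + Real.binEntropy s) ≤ ∫ y in I, softplus (f y) := by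
    apply setIntegral_mono
    · exact (hi1.const_mul s).add (integrableOn_const (by simp [I]))
    · exact hi2
    · intro y
      exact mul_add_binEntropy_le_softplus h0.le h1.le _
  rw [integral_add (hi1.const_mul s) (integrableOn_const (by simp [I])),
    integral_const_mul, setIntegral_const, hv, smul_eq_mul] at key
  have := mul_le_mul_of_nonneg_left key hn.le
  have e : n * (1 / n * Real.binEntropy s) = Real.binEntropy s := by field_simp
  nlinarith

end Softplus

section Density

variable {μ : FiniteMeasure ℝ}

lemma Leb01_le_volume : Leb01 ≤ volume := Measure.restrict_le_self

instance : IsFiniteMeasure Leb01 := by unfold Leb01; infer_instance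

lemma measurable_dens (μ : FiniteMeasure ℝ) : Measurable (dens μ) :=
  (Measure.measurable_rnDeriv _ _).ennreal_toReal

lemma dens_nonneg (μ : FiniteMeasure ℝ) (x : ℝ) : 0 ≤ dens μ x := ENNReal.toReal_nonneg

lemma dens_le_one (h : (μ : Measure ℝ) ≤ Leb01) : ∀ᵐ x, dens μ x ≤ 1 := by
  filter_upwards [Measure.rnDeriv_le_one_of_le (h.trans Leb01_le_volume)] with x hx
  exact ENNReal.toReal_le_of_le_ofReal zero_le_one (by simpa using hx)

lemma absolutelyContinuous_of_le_Leb01 (h : (μ : Measure ℝ) ≤ Leb01) :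
    (μ : Measure ℝ) ≪ volume :=
  Measure.absolutelyContinuous_of_le (h.trans Leb01_le_volume)

lemma restrict_Icc_eq_self (h : (μ : Measure ℝ) ≤ Leb01) :
    (μ : Measure ℝ).restrict (Icc 0 1) = μ := by
  apply Measure.restrict_eq_self_of_ae_mem
  have : ∀ᵐ x ∂Leb01, x ∈ Icc (0:ℝ) 1 := ae_restrict_mem measurableSet_Icc
  exact (Measure.absolutelyContinuous_of_le h).ae_le this

lemma setIntegral_dens_mul (h : (μ : Measure ℝ) ≤ Leb01) {s : Set ℝ} (hs : MeasurableSet s)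
    (f : ℝ → ℝ) : ∫ x in s, dens μ x * f x = ∫ x in s, f x ∂(μ : Measure ℝ) :=
  setIntegral_rnDeriv_smul (absolutelyContinuous_of_le_Leb01 h) hs

lemma setIntegral_Icc_dens_mul (h : (μ : Measure ℝ) ≤ Leb01) (f : ℝ → ℝ) :
    ∫ x in Icc (0:ℝ) 1, dens μ x * f x = ∫ x, f x ∂(μ : Measure ℝ) := by
  rw [setIntegral_dens_mul h measurableSet_Icc, restrict_Icc_eq_self h]

lemma integrableOn_of_measurable_of_abs_le {f : ℝ → ℝ} {a b : ℝ} (hf : Measurable f) {C : ℝ}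
    (hC : ∀ᵐ x, |f x| ≤ C) : IntegrableOn f (Icc a b) := by
  apply Measure.integrableOn_of_bounded (by simp) hf.aestronglyMeasurable
  exact ae_restrict_of_ae hC

/-- The integral over `[0,1]` of the binary entropy of the density. -/
def densEntropy (μ : FiniteMeasure ℝ) : ℝ := ∫ x in Icc (0:ℝ) 1, Real.binEntropy (dens μ x)

lemma abs_binEntropy_dens_le (h : (μ : Measure ℝ) ≤ Leb01) :
    ∀ᵐ x, |Real.binEntropy (dens μ x)| ≤ Real.log 2 := by
  filter_upwards [dens_le_one h] with x hx
  rw [abs_of_nonneg (Real.binEntropy_nonneg (dens_nonneg _ _) hx)]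
  exact Real.binEntropy_le_log_two

lemma integrableOn_binEntropy_dens (h : (μ : Measure ℝ) ≤ Leb01) {a b : ℝ} :
    IntegrableOn (fun x => Real.binEntropy (dens μ x)) (Icc a b) :=
  integrableOn_of_measurable_of_abs_le
    (Real.binEntropy_continuous.measurable.comp (measurable_dens μ)) (abs_binEntropy_dens_le h)

lemma densEntropy_nonneg (h : (μ : Measure ℝ) ≤ Leb01) : 0 ≤ densEntropy μ := by
  apply integral_nonneg_of_ae
  apply ae_restrict_of_ae
  filter_upwards [dens_le_one h] with x hx
  exact Real.binEntropy_nonneg (dens_nonneg _ _) hx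

lemma densEntropy_le_log_two (h : (μ : Measure ℝ) ≤ Leb01) : densEntropy μ ≤ Real.log 2 := by
  calc densEntropy μ ≤ ∫ x in Icc (0:ℝ) 1, Real.log 2 := by
        apply integral_mono (integrableOn_binEntropy_dens h) (integrableOn_const (by simp))
        intro x
        exact Real.binEntropy_le_log_two
    _ = _ := by simp

lemma integrableOn_dens (h : (μ : Measure ℝ) ≤ Leb01) {a b : ℝ} :
    IntegrableOn (dens μ) (Icc a b) :=
  integrableOn_of_measurable_of_abs_le (measurable_dens μ) (C := 1) (by
    filter_upwards [dens_le_one h] with x hx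
    rwa [abs_of_nonneg (dens_nonneg _ _)])

lemma integrableOn_dens_mul (h : (μ : Measure ℝ) ≤ Leb01) {f : ℝ → ℝ}
    (hf : IntegrableOn f (Icc 0 1)) : IntegrableOn (fun x => dens μ x * f x) (Icc 0 1) := by
  refine Integrable.mono hf ((measurable_dens μ).aestronglyMeasurable.mul
    hf.aestronglyMeasurable) ?_
  apply ae_restrict_of_ae
  filter_upwards [dens_le_one h] with x hx
  rw [norm_mul, Real.norm_of_nonneg (dens_nonneg _ _)]
  exact mul_le_of_le_one_left (norm_nonneg _) hx

/-- Integrated Young inequality. -/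
lemma integral_add_densEntropy_le (h : (μ : Measure ℝ) ≤ Leb01) {f : ℝ → ℝ} (hf : Continuous f) :
    ∫ x, f x ∂(μ : Measure ℝ) + densEntropy μ ≤ ∫ x in Icc (0:ℝ) 1, softplus (f x) := by
  have hfi : IntegrableOn f (Icc 0 1) := hf.continuousOn.integrableOn_compact isCompact_Icc
  rw [← setIntegral_Icc_dens_mul h, densEntropy, ← integral_add (integrableOn_dens_mul h hfi)
    (integrableOn_binEntropy_dens h)]
  apply integral_mono_ae ((integrableOn_dens_mul h hfi).add (integrableOn_binEntropy_dens h))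
    ((continuous_softplus.comp hf).continuousOn.integrableOn_compact isCompact_Icc)
  apply ae_restrict_of_ae
  filter_upwards [dens_le_one h] with x hx
  exact mul_add_binEntropy_le_softplus (dens_nonneg _ _) hx _

lemma neg_log_contraction_le {r δ : ℝ} (h0 : 0 ≤ r) (hδ : 0 < δ) (hδ' : δ < 1 / 2) :
    r * (- Real.log ((1 - 2 * δ) * r + δ)) ≤ r * (- Real.log r) + r * (- Real.log (1 - 2 * δ)) := by
  rcases h0.eq_or_lt with rfl | hr
  · simp
  · rw [← mul_add]
    apply mul_le_mul_of_nonneg_left _ h0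
    have h1 : 0 < 1 - 2 * δ := by linarith
    have := Real.log_le_log (mul_pos h1 hr) (show (1 - 2 * δ) * r ≤ (1 - 2 * δ) * r + δ by linarith)
    rw [Real.log_mul h1.ne' hr.ne'] at this
    linarith

/-- Sharpness of the integrated Young inequality. -/
lemma exists_integral_softplus_le (h : (μ : Measure ℝ) ≤ Leb01) {ε : ℝ} (hε : 0 < ε) :
    ∃ f : BoundedContinuousFunction ℝ ℝ, ∫ x in Icc (0:ℝ) 1, softplus (f x) ≤
      ∫ x, f x ∂(μ : Measure ℝ) + densEntropy μ + ε := by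
  obtain ⟨δ, hδ, hδ2, hδlog⟩ : ∃ δ : ℝ, 0 < δ ∧ δ < 1 / 2 ∧ - Real.log (1 - 2 * δ) ≤ ε / 3 := by
    have h1 : Real.exp (-(ε / 3)) < 1 := by rw [Real.exp_lt_one_iff]; linarith
    have h2 := Real.exp_pos (-(ε / 3))
    refine ⟨(1 - Real.exp (-(ε / 3))) / 2, by linarith, by linarith, ?_⟩
    have : 1 - 2 * ((1 - Real.exp (-(ε / 3))) / 2) = Real.exp (-(ε / 3)) := by ring
    rw [this, Real.log_exp]
    linarith
  set c : ℝ → ℝ := fun x => (1 - 2 * δ) * dens μ x + δ with hc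
  have hcm : Measurable c := ((measurable_dens μ).const_mul _).add_const _
  set g : ℝ → ℝ := fun x => Real.log (c x) - Real.log (1 - c x) with hg
  have hgm : Measurable g := (Real.measurable_log.comp hcm).sub
    (Real.measurable_log.comp (measurable_const.sub hcm))
  have hcb : ∀ᵐ x, δ ≤ c x ∧ c x ≤ 1 - δ := by
    filter_upwards [dens_le_one h] with x hx
    have := dens_nonneg μ x
    constructor <;> simp only [hc] <;> nlinarith
  have hgi : IntegrableOn g (Icc 0 1) := by
    apply integrableOn_of_measurable_of_abs_le hgm (C := - Real.log δ)
    filter_upwards [hcb] with x hx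
    have a1 := Real.log_le_log hδ hx.1
    have a2 := Real.log_le_log hδ (show δ ≤ 1 - c x by linarith)
    have a3 := Real.log_nonpos (show 0 ≤ c x by linarith) (by linarith)
    have a4 := Real.log_nonpos (show 0 ≤ 1 - c x by linarith) (by linarith)
    rw [abs_le]
    constructor <;> simp only [hg] <;> linarith
  obtain ⟨f, hf, hfi⟩ := Integrable.exists_boundedContinuous_integral_sub_le (μ := Leb01) hgi
    (show 0 < ε / 3 by linarith)
  refine ⟨f, ?_⟩
  have hfi' : IntegrableOn f (Icc 0 1) := hfi
  have hd : IntegrableOn (fun x => ‖g x - f x‖) (Icc 0 1) := (hgi.sub hfi').norm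
  have hf' : ∫ x in Icc (0:ℝ) 1, ‖g x - f x‖ ≤ ε / 3 := hf
  rw [← setIntegral_Icc_dens_mul h, densEntropy]
  have i1 : IntegrableOn (fun x => dens μ x * f x + Real.binEntropy (dens μ x)) (Icc 0 1) :=
    (integrableOn_dens_mul h hfi').add (integrableOn_binEntropy_dens h)
  have i2 : IntegrableOn (fun x => ε / 3 + 2 * ‖g x - f x‖) (Icc 0 1) :=
    (integrableOn_const (by simp)).add (hd.const_mul 2)
  have key : ∫ x in Icc (0:ℝ) 1, softplus (f x) ≤ ∫ x in Icc (0:ℝ) 1,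
      (dens μ x * f x + Real.binEntropy (dens μ x) + (ε / 3 + 2 * ‖g x - f x‖)) := by
    apply integral_mono_ae
      ((continuous_softplus.comp f.continuous).continuousOn.integrableOn_compact isCompact_Icc)
      (i1.add i2)
    apply ae_restrict_of_ae
    filter_upwards [dens_le_one h, hcb] with x hx hcx
    have hx0 := dens_nonneg μ x
    have b1 := softplus_sub_le (f x) (g x)
    rw [abs_sub_comm] at b1
    have b2 : softplus (g x) = - Real.log (1 - c x) :=
      softplus_log_sub_log (by linarith) (by linarith)
    have b3 : dens μ x * g x - dens μ x * f x ≤ |g x - f x| := by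
      rw [← mul_sub]
      calc _ ≤ dens μ x * |g x - f x| := mul_le_mul_of_nonneg_left (le_abs_self _) hx0
        _ ≤ _ := mul_le_of_le_one_left (abs_nonneg _) hx
    have b4 := neg_log_contraction_le hx0 hδ hδ2
    have b5 := neg_log_contraction_le (show 0 ≤ 1 - dens μ x by linarith) hδ hδ2
    have b6 : (1 - 2 * δ) * (1 - dens μ x) + δ = 1 - c x := by simp only [hc]; ring
    rw [b6] at b5
    change dens μ x * -Real.log (c x) ≤ _ at b4
    simp only [Pi.add_apply, Function.comp_apply]
    rw [Real.norm_eq_abs, Real.binEntropy, Real.log_inv, Real.log_inv]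
    have b7 : dens μ x * g x = dens μ x * Real.log (c x) - dens μ x * Real.log (1 - c x) := by
      simp only [hg]; ring
    nlinarith
  rw [integral_add i1 i2,
    integral_add (integrableOn_dens_mul h hfi') (integrableOn_binEntropy_dens h),
    integral_add (integrable_const _) (hd.const_mul 2), integral_const_mul] at key
  have : ∫ x in Icc (0:ℝ) 1, ε / 3 = ε / 3 := by simp
  linarith

end Density

section Topology

open scoped Topology

lemma real_Icc_sub_le_of_le_Leb01 {ν : Measure ℝ} (h : ν ≤ Leb01) {x y : ℝ} (hxy : x ≤ y) :
    ν.real (Icc 0 y) - ν.real (Icc 0 x) ≤ y - x := by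
  have : IsFiniteMeasure ν := isFiniteMeasure_of_le _ h
  have h1 : Icc 0 y ⊆ Icc 0 x ∪ Icc x y := by
    intro z hz
    rcases le_total z x with e | e
    · exact Or.inl ⟨hz.1, e⟩
    · exact Or.inr ⟨e, hz.2⟩
  have h2 : ν.real (Icc x y) ≤ y - x := by
    have : ν (Icc x y) ≤ volume (Icc x y) := (h.trans Leb01_le_volume) _
    rw [Real.volume_Icc] at this
    exact ENNReal.toReal_le_of_le_ofReal (by linarith) this
  have := (measureReal_mono h1 (μ := ν)).trans (measureReal_union_le _ _)
  linarith

lemma real_Icc_mono {ν : Measure ℝ} [IsFiniteMeasure ν] {x y : ℝ} (hxy : x ≤ y) :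
    ν.real (Icc 0 x) ≤ ν.real (Icc 0 y) := measureReal_mono (Icc_subset_Icc_right hxy)

lemma real_Icc_le_one {ν : Measure ℝ} (h : ν ≤ Leb01) (x : ℝ) : ν.real (Icc 0 x) ≤ 1 := by
  have : ν (Icc 0 x) ≤ volume (Icc (0:ℝ) 1) := by
    refine (h _).trans ?_
    rw [Leb01, Measure.restrict_apply' measurableSet_Icc]
    exact measure_mono inter_subset_right
  rw [Real.volume_Icc] at this
  exact ENNReal.toReal_le_of_le_ofReal (by norm_num) (by simpa using this)

lemma measure_singleton_of_le_Leb01 {ν : Measure ℝ} (h : ν ≤ Leb01) (x : ℝ) : ν {x} = 0 :=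
  le_antisymm (((h.trans Leb01_le_volume) _).trans (by simp)) bot_le

lemma measure_compl_Icc_of_le_Leb01 {ν : Measure ℝ} (h : ν ≤ Leb01) : ν (Icc 0 1)ᶜ = 0 := by
  refine le_antisymm ((h _).trans ?_) bot_le
  rw [Leb01, Measure.restrict_apply measurableSet_Icc.compl]
  simp

lemma real_Icc_nonpos {ν : Measure ℝ} (h : ν ≤ Leb01) {x : ℝ} (hx : x ≤ 0) :
    ν.real (Icc 0 x) = 0 := by
  have : ν (Icc 0 x) = 0 := by
    apply measure_mono_null _ (measure_singleton_of_le_Leb01 h 0)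
    intro z hz
    exact le_antisymm (hz.2.trans hx) hz.1
  simp [Measure.real, this]

lemma measure_univ_of_le_Leb01 {ν : Measure ℝ} (h : ν ≤ Leb01) {x : ℝ} (hx : 1 ≤ x) :
    ν univ = ν (Icc 0 x) := by
  refine le_antisymm ?_ (measure_mono (subset_univ _))
  have : (univ : Set ℝ) ⊆ Icc 0 x ∪ (Icc 0 1)ᶜ := by
    intro z _
    by_cases hz : z ∈ Icc (0:ℝ) 1
    · exact Or.inl ⟨hz.1, hz.2.trans hx⟩
    · exact Or.inr hz
  refine (measure_mono this).trans ((measure_union_le _ _).trans ?_)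
  rw [measure_compl_Icc_of_le_Leb01 h, add_zero]

lemma real_Ioc_of_nonneg {ν : Measure ℝ} [IsFiniteMeasure ν] {x y : ℝ}
    (hx : 0 ≤ x) (hxy : x ≤ y) :
    ν.real (Ioc x y) = ν.real (Icc 0 y) - ν.real (Icc 0 x) := by
  have h1 : Icc 0 y = Icc 0 x ∪ Ioc x y := (Icc_union_Ioc_eq_Icc hx hxy).symm
  have h2 : Disjoint (Icc 0 x) (Ioc x y) := by
    rw [Set.disjoint_left]
    intro z hz hz'
    exact absurd hz.2 (not_le.2 hz'.1)
  rw [h1, measureReal_union h2 measurableSet_Ioc]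
  ring

/-- Approximation of the integral of a function by a Riemann-Stieltjes sum. -/
lemma abs_integral_sub_sum_le {ν : Measure ℝ} (h : ν ≤ Leb01) {f : ℝ → ℝ} (hf : Continuous f)
    {N : ℕ} (hN : 0 < N) {ε : ℝ} (hfε : ∀ x ∈ Icc (0:ℝ) 1, ∀ y ∈ Icc (0:ℝ) 1, |x - y| ≤ 1 / N →
      |f x - f y| ≤ ε) :
    |∫ x, f x ∂ν - ∑ k ∈ Finset.range N, f (k / N) *
      (ν.real (Icc 0 (((k + 1 : ℕ) : ℝ) / N)) - ν.real (Icc 0 ((k : ℝ) / N)))| ≤ ε := by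
  have : IsFiniteMeasure ν := isFiniteMeasure_of_le _ h
  have hN' : (0:ℝ) < N := by exact_mod_cast hN
  have hε : 0 ≤ ε := by
    have := hfε 0 (by simp) 0 (by simp) (by simp)
    simpa using this
  have h1 : ∫ x, f x ∂ν = ∫ x in (0:ℝ)..1, f x ∂ν := by
    rw [intervalIntegral.integral_of_le zero_le_one, Measure.restrict_eq_self_of_ae_mem]
    rw [ae_iff]
    apply measure_mono_null (t := {0} ∪ (Icc 0 1)ᶜ)
    · intro x hx
      simp only [mem_Ioc, not_and, not_le, Set.mem_ofPred_eq] at hx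
      by_cases hx0 : x = 0
      · exact Or.inl hx0
      · right
        intro hx2
        exact absurd (hx (lt_of_le_of_ne hx2.1 (Ne.symm hx0))) (not_lt.2 hx2.2)
    · rw [measure_union_null_iff]
      exact ⟨measure_singleton_of_le_Leb01 h 0, measure_compl_Icc_of_le_Leb01 h⟩
  have h2 := intervalIntegral.sum_integral_adjacent_intervals (f := f) (μ := ν)
    (a := fun k : ℕ => (k : ℝ) / N) (n := N) (fun k _ => hf.intervalIntegrable _ _)
  simp only [CharP.cast_eq_zero, zero_div, div_self hN'.ne'] at h2
  rw [h1, ← h2, ← Finset.sum_sub_distrib]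
  refine (Finset.abs_sum_le_sum_abs _ _).trans ?_
  have h3 : ∀ k ∈ Finset.range N, |∫ x in ((k:ℝ) / N)..(((k + 1 : ℕ) : ℝ) / N), f x ∂ν -
      f (k / N) * (ν.real (Icc 0 (((k + 1 : ℕ) : ℝ) / N)) - ν.real (Icc 0 ((k : ℝ) / N)))| ≤
      ε * (1 / N) := by
    intro k hk
    have hk' : ((k + 1 : ℕ) : ℝ) ≤ N := by exact_mod_cast Finset.mem_range.1 hk
    have hle : (k:ℝ) / N ≤ ((k + 1 : ℕ) : ℝ) / N := by gcongr; simp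
    have hk0 : (0:ℝ) ≤ k / N := by positivity
    have hk1 : ((k + 1 : ℕ) : ℝ) / N ≤ 1 := by rw [div_le_one hN']; exact hk'
    have hd : ((k + 1 : ℕ) : ℝ) / N - k / N = 1 / N := by push_cast; ring
    rw [← real_Ioc_of_nonneg hk0 hle, intervalIntegral.integral_of_le hle]
    have e1 : f (k / N) * ν.real (Ioc ((k:ℝ) / N) (((k + 1 : ℕ) : ℝ) / N)) =
        ∫ x in Ioc ((k:ℝ) / N) (((k + 1 : ℕ) : ℝ) / N), f (k / N) ∂ν := by
      rw [setIntegral_const, smul_eq_mul, mul_comm]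
    have hfi : IntegrableOn f (Ioc ((k:ℝ) / N) (((k + 1 : ℕ) : ℝ) / N)) ν :=
      (hf.continuousOn.integrableOn_compact isCompact_Icc).mono_set Ioc_subset_Icc_self
    rw [e1, ← integral_sub hfi (integrable_const _), ← Real.norm_eq_abs]
    refine (norm_setIntegral_le_of_norm_le_const (C := ε) (by simp) ?_).trans ?_
    · intro x hx
      rw [Real.norm_eq_abs]
      apply hfε
      · exact ⟨hk0.trans hx.1.le, hx.2.trans hk1⟩
      · exact ⟨hk0, hle.trans hk1⟩
      · rw [abs_of_nonneg (by linarith [hx.1])]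
        linarith [hx.2]
    · apply mul_le_mul_of_nonneg_left _ hε
      rw [real_Ioc_of_nonneg hk0 hle, ← hd]
      exact real_Icc_sub_le_of_le_Leb01 h hle
  refine (Finset.sum_le_sum h3).trans ?_
  rw [Finset.sum_const, Finset.card_range, nsmul_eq_mul]
  apply le_of_eq
  field_simp

/-- For measures dominated by Lebesgue measure on `[0,1]`, pointwise convergence of distribution
functions implies weak convergence. -/
lemma tendsto_of_tendsto_real_Icc {ι : Type*} {l : Filter ι} {μs : ι → FiniteMeasure ℝ}
    {μ : FiniteMeasure ℝ} (hμs : ∀ i, (μs i : Measure ℝ) ≤ Leb01) (hμ : (μ : Measure ℝ) ≤ Leb01)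
    (h : ∀ x ∈ Icc (0:ℝ) 1, Tendsto (fun i => (μs i : Measure ℝ).real (Icc 0 x)) l
      (𝓝 ((μ : Measure ℝ).real (Icc 0 x)))) : Tendsto μs l (𝓝 μ) := by
  rw [FiniteMeasure.tendsto_iff_forall_integral_tendsto]
  intro f
  rw [Metric.tendsto_nhds]
  intro ε hε
  have huc := isCompact_Icc.uniformContinuousOn_of_continuous
    (f.continuous.continuousOn (s := Icc (0:ℝ) 1))
  rw [Metric.uniformContinuousOn_iff] at huc
  obtain ⟨δ, hδ, hfδ⟩ := huc (ε / 4) (by linarith)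
  obtain ⟨N, hN⟩ := exists_nat_one_div_lt hδ
  have hfε : ∀ x ∈ Icc (0:ℝ) 1, ∀ y ∈ Icc (0:ℝ) 1, |x - y| ≤ 1 / ((N + 1 : ℕ) : ℝ) →
      |f x - f y| ≤ ε / 4 := by
    intro x hx y hy hxy
    have := hfδ x hx y hy (by
      rw [Real.dist_eq]; refine hxy.trans_lt ?_; push_cast; exact hN)
    rw [Real.dist_eq] at this
    exact this.le
  have hlim : Tendsto (fun i => ∑ k ∈ Finset.range (N + 1), f (k / (N + 1 : ℕ)) *
      ((μs i : Measure ℝ).real (Icc 0 (((k + 1 : ℕ) : ℝ) / (N + 1 : ℕ))) -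
        (μs i : Measure ℝ).real (Icc 0 ((k : ℝ) / (N + 1 : ℕ))))) l
      (𝓝 (∑ k ∈ Finset.range (N + 1), f (k / (N + 1 : ℕ)) *
      ((μ : Measure ℝ).real (Icc 0 (((k + 1 : ℕ) : ℝ) / (N + 1 : ℕ))) -
        (μ : Measure ℝ).real (Icc 0 ((k : ℝ) / (N + 1 : ℕ)))))) := by
    apply tendsto_finsetSum
    intro k hk
    have hN0 : (0:ℝ) < ((N + 1 : ℕ) : ℝ) := by positivity
    have hk' : ((k + 1 : ℕ) : ℝ) ≤ (N + 1 : ℕ) := by exact_mod_cast Finset.mem_range.1 hk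
    have hk'' : (k : ℝ) ≤ (N + 1 : ℕ) := le_trans (by simp) hk'
    apply Tendsto.const_mul
    apply Tendsto.sub
    · exact h _ ⟨by positivity, by rwa [div_le_one hN0]⟩
    · exact h _ ⟨by positivity, by rwa [div_le_one hN0]⟩
  rw [Metric.tendsto_nhds] at hlim
  filter_upwards [hlim (ε / 4) (by linarith)] with i hi
  have a1 := abs_integral_sub_sum_le (hμs i) f.continuous (Nat.succ_pos N) hfε
  have a2 := abs_integral_sub_sum_le hμ f.continuous (Nat.succ_pos N) hfε
  rw [Real.dist_eq] at hi ⊢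
  rw [abs_lt] at hi ⊢
  rw [abs_le] at a1 a2
  constructor <;> linarith [hi.1, hi.2, a1.1, a1.2, a2.1, a2.2]

lemma exists_limit_of_ultrafilter {ι : Type*} (U : Ultrafilter ι) {μs : ι → FiniteMeasure ℝ}
    (hμs : ∀ i, (μs i : Measure ℝ) ≤ Leb01) :
    ∃ μ : FiniteMeasure ℝ, (μ : Measure ℝ) ≤ Leb01 ∧
      ∀ x, Tendsto (fun i => (μs i : Measure ℝ).real (Icc 0 x)) U
        (𝓝 ((μ : Measure ℝ).real (Icc 0 x))) := by
  have hex : ∀ x : ℝ, ∃ y : ℝ, Tendsto (fun i => (μs i : Measure ℝ).real (Icc 0 x)) U (𝓝 y) := by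
    intro x
    obtain ⟨y, -, hy⟩ := isCompact_Icc.ultrafilter_le_nhds
      (U.map (fun i => (μs i : Measure ℝ).real (Icc 0 x))) (s := Icc (0:ℝ) 1) (by
        rw [le_principal_iff, Ultrafilter.coe_map, mem_map]
        exact Filter.univ_mem' fun i =>
          ⟨measureReal_nonneg, real_Icc_le_one (hμs i) x⟩)
    exact ⟨y, hy⟩
  choose F hF using hex
  have hmono : Monotone F := fun x y hxy =>
    le_of_tendsto_of_tendsto' (hF x) (hF y) fun i => real_Icc_mono hxy
  have hlip : ∀ x y, x ≤ y → F y - F x ≤ y - x := fun x y hxy =>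
    le_of_tendsto' ((hF y).sub (hF x)) fun i => real_Icc_sub_le_of_le_Leb01 (hμs i) hxy
  have hneg : ∀ x ≤ 0, F x = 0 := fun x hx => tendsto_nhds_unique (hF x) (by
    refine tendsto_const_nhds.congr fun i => ?_
    rw [real_Icc_nonpos (hμs i) hx])
  have hone : ∀ x, 1 ≤ x → F x = F 1 := fun x hx => tendsto_nhds_unique (hF x) (by
    refine (hF 1).congr fun i => ?_
    rw [Measure.real, Measure.real, ← measure_univ_of_le_Leb01 (hμs i) hx,
      ← measure_univ_of_le_Leb01 (hμs i) le_rfl])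
  have hcont : Continuous F := by
    have : LipschitzWith 1 F := LipschitzWith.of_dist_le_mul fun x y => by
      rw [Real.dist_eq, Real.dist_eq, NNReal.coe_one, one_mul]
      rcases le_total x y with e | e
      · rw [abs_sub_comm, abs_sub_comm x, abs_of_nonneg (sub_nonneg.2 (hmono e)),
          abs_of_nonneg (sub_nonneg.2 e)]
        exact hlip x y e
      · rw [abs_of_nonneg (sub_nonneg.2 (hmono e)), abs_of_nonneg (sub_nonneg.2 e)]
        exact hlip y x e
    exact this.continuous
  let SF : StieltjesFunction ℝ := ⟨F, hmono, fun x => hcont.continuousWithinAt⟩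
  let SG : StieltjesFunction ℝ := ⟨fun x => x - F x,
    fun x y hxy => by have := hlip x y hxy; simp only; linarith,
    fun x => (continuous_id.sub hcont).continuousWithinAt⟩
  have hadd : SF.measure + SG.measure = volume := by
    rw [← StieltjesFunction.measure_add, Real.volume_eq_stieltjes_id]
    congr 1
    ext x
    show F x + (x - F x) = x
    ring
  have hvol : SF.measure ≤ volume := by rw [← hadd]; exact Measure.le_add_right le_rfl
  have hbot : Tendsto SF atBot (𝓝 0) := tendsto_const_nhds.congr' (by
    filter_upwards [eventually_le_atBot 0] with x hx
    exact (hneg x hx).symm)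
  have htop : Tendsto SF atTop (𝓝 (F 1)) := tendsto_const_nhds.congr' (by
    filter_upwards [eventually_ge_atTop 1] with x hx
    exact (hone x hx).symm)
  have hle : SF.measure ≤ Leb01 := by
    have hres : SF.measure.restrict (Icc 0 1) = SF.measure := by
      apply Measure.restrict_eq_self_of_ae_mem
      rw [ae_iff]
      apply measure_mono_null (t := Iic 0 ∪ Ioi 1)
      · intro x hx
        by_contra hcon
        simp only [mem_union, mem_Iic, mem_Ioi, not_or, not_le, not_lt] at hcon
        exact hx ⟨hcon.1.le, hcon.2⟩
      · rw [measure_union_null_iff, StieltjesFunction.measure_Iic _ hbot,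
          StieltjesFunction.measure_Ioi _ htop]
        constructor
        · show ENNReal.ofReal (F 0 - 0) = 0
          rw [hneg 0 le_rfl]; simp
        · show ENNReal.ofReal (F 1 - F 1) = 0
          simp
    rw [← hres]
    exact Measure.restrict_mono_measure hvol _
  have : IsFiniteMeasure SF.measure := isFiniteMeasure_of_le _ hle
  refine ⟨⟨SF.measure, inferInstance⟩, hle, fun x => ?_⟩
  have hval : SF.measure.real (Icc 0 x) = F x := by
    rcases le_total x 0 with hx | hx
    · rw [hneg x hx]
      exact real_Icc_nonpos hle hx
    · have h0 : SF.measure (Icc 0 x) = ENNReal.ofReal (F x) := by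
        rw [StieltjesFunction.measure_Icc]
        have : Function.leftLim SF 0 = 0 := by
          have h1 : Function.leftLim SF 0 = SF 0 :=
            (hmono.leftLim_le le_rfl).antisymm (by
              change F 0 ≤ Function.leftLim F 0
              rw [hneg 0 le_rfl]
              have := hmono.le_leftLim (show (-1:ℝ) < 0 by norm_num)
              rw [hneg (-1) (by norm_num)] at this
              exact this)
          rw [h1]; exact hneg 0 le_rfl
        rw [this, sub_zero]
      rw [Measure.real, h0, ENNReal.toReal_ofReal]
      rw [← hneg 0 le_rfl]; exact hmono hx
  change Tendsto _ _ (𝓝 (SF.measure.real (Icc 0 x)))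
  rw [hval]
  exact hF x

/-- The inclusion of `Dspace` in the space of pairs of finite measures. -/
def Dspace.toPair (p : Dspace) : FiniteMeasure ℝ × FiniteMeasure ℝ := p.1

lemma Dspace.isInducing_toPair : Topology.IsInducing Dspace.toPair := ⟨rfl⟩

lemma Dspace.continuous_val_fst : Continuous (fun p : Dspace => p.1.1) :=
  continuous_fst.comp Dspace.isInducing_toPair.continuous

lemma Dspace.continuous_val_snd : Continuous (fun p : Dspace => p.1.2) :=
  continuous_snd.comp Dspace.isInducing_toPair.continuous

lemma Dspace.tendsto_of_tendsto {ι : Type*} {l : Filter ι} {q : ι → Dspace} {p : Dspace}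
    (h1 : Tendsto (fun i => (q i).1.1) l (𝓝 p.1.1))
    (h2 : Tendsto (fun i => (q i).1.2) l (𝓝 p.1.2)) : Tendsto q l (𝓝 p) := by
  rw [Dspace.isInducing_toPair.tendsto_nhds_iff]
  exact h1.prodMk_nhds h2

instance : CompactSpace Dspace := by
  constructor
  rw [isCompact_iff_ultrafilter_le_nhds]
  intro U _
  obtain ⟨μ, hμ, hμF⟩ := exists_limit_of_ultrafilter U (μs := fun p : Dspace => p.1.1)
    (fun p => p.2.1)
  obtain ⟨ν, hν, hνF⟩ := exists_limit_of_ultrafilter U (μs := fun p : Dspace => p.1.2)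
    (fun p => p.2.2.1)
  have hmem : MemD μ ν := by
    refine ⟨hμ, hν, ?_, fun x => ?_⟩
    · rw [measure_univ_of_le_Leb01 hμ le_rfl, measure_univ_of_le_Leb01 hν le_rfl]
      have := tendsto_nhds_unique (hμF 1) ((hνF 1).congr fun p => by
        rw [Measure.real, Measure.real, ← measure_univ_of_le_Leb01 p.2.1 le_rfl,
          ← measure_univ_of_le_Leb01 p.2.2.1 le_rfl, p.2.2.2.1])
      exact (ENNReal.toReal_eq_toReal_iff' (measure_ne_top _ _) (measure_ne_top _ _)).1 this
    · have := le_of_tendsto_of_tendsto' (hμF x) (hνF x) fun p =>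
        ENNReal.toReal_mono (measure_ne_top _ _) (p.2.2.2.2 x)
      exact (ENNReal.toReal_le_toReal (measure_ne_top _ _) (measure_ne_top _ _)).1 this
  refine ⟨⟨(μ, ν), hmem⟩, mem_univ _, ?_⟩
  exact Dspace.tendsto_of_tendsto (q := id)
    (tendsto_of_tendsto_real_Icc (fun p => p.2.1) hμ fun x _ => hμF x)
    (tendsto_of_tendsto_real_Icc (fun p => p.2.2.1) hν fun x _ => hνF x)

end Topology

section Cells

variable {n : ℕ}

/-- Lebesgue measure restricted to the cells of `[0,1]` indexed by `A`. -/
def cellMeasure (A : Finset (Fin n)) : Measure ℝ :=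
  ∑ a ∈ A, volume.restrict (Icc (((a : ℕ) : ℝ) / n) ((((a : ℕ) : ℝ) + 1) / n))

lemma pi1_eq_cellMeasure (σ : Equiv.Perm (Fin n)) : pi1 σ = cellMeasure (RLMpositions σ) := rfl

lemma pi2_eq_cellMeasure (σ : Equiv.Perm (Fin n)) :
    pi2 σ = cellMeasure ((RLMpositions σ).image σ) := by
  rw [cellMeasure, Finset.sum_image σ.injective.injOn]
  rfl

lemma integral_cellMeasure (A : Finset (Fin n)) {f : ℝ → ℝ} (hf : Continuous f) :
    ∫ x, f x ∂(cellMeasure A) =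
      ∑ a ∈ A, ∫ x in Icc (((a : ℕ) : ℝ) / n) ((((a : ℕ) : ℝ) + 1) / n), f x :=
  integral_finsetSum_measure fun _ _ =>
    hf.continuousOn.integrableOn_compact isCompact_Icc

lemma sum_setIntegral_cells (hn : 0 < n) {f : ℝ → ℝ} (hf : Continuous f) :
    ∑ a : Fin n, ∫ x in Icc (((a : ℕ) : ℝ) / n) ((((a : ℕ) : ℝ) + 1) / n), f x =
      ∫ x in Icc (0:ℝ) 1, f x := by
  have hn' : (0:ℝ) < n := by exact_mod_cast hn
  have h2 := intervalIntegral.sum_integral_adjacent_intervals (f := f) (μ := volume)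
    (a := fun k : ℕ => (k : ℝ) / n) (n := n) (fun k _ => hf.intervalIntegrable _ _)
  simp only [CharP.cast_eq_zero, zero_div, div_self hn'.ne'] at h2
  rw [integral_Icc_eq_integral_Ioc, ← intervalIntegral.integral_of_le zero_le_one, ← h2,
    Fin.sum_univ_eq_sum_range
      (fun k : ℕ => ∫ x in Icc ((k : ℝ) / n) (((k : ℝ) + 1) / n), f x) n]
  refine Finset.sum_congr rfl fun k _ => ?_
  rw [integral_Icc_eq_integral_Ioc, intervalIntegral.integral_of_le (by gcongr; simp)]
  push_cast
  rfl

lemma sum_exp_integral_cellMeasure_le (hn : 0 < n) {f : ℝ → ℝ} (hf : Continuous f) :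
    ∑ A : Finset (Fin n), Real.exp (n * ∫ x, f x ∂(cellMeasure A)) ≤
      Real.exp (n * ∫ x in Icc (0:ℝ) 1, softplus (f x)) := by
  have hn_pos : (0:ℝ) < n := by exact_mod_cast hn
  have h1 : ∀ A : Finset (Fin n), Real.exp (n * ∫ x, f x ∂(cellMeasure A)) = ∏ a ∈ A,
      Real.exp (n * ∫ x in Icc (((a : ℕ) : ℝ) / n) ((((a : ℕ) : ℝ) + 1) / n), f x) := by
    intro A
    rw [integral_cellMeasure A hf, Finset.mul_sum, Real.exp_sum]
  simp_rw [h1]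
  rw [← Finset.powerset_univ, ← Finset.prod_one_add]
  simp_rw [← exp_softplus]
  rw [← Real.exp_sum, ← sum_setIntegral_cells hn
    (f := fun x => softplus (f x)) (continuous_softplus.comp hf), Finset.mul_sum]
  apply Real.exp_le_exp.2
  exact Finset.sum_le_sum fun a _ => softplus_mul_setIntegral_le hf hn_pos

/-- Exponential moment bound for the pairs of measures of `321`-avoiding permutations. -/
lemma sum_exp_avoids321_le (hn : 0 < n) {f g : ℝ → ℝ} (hf : Continuous f) (hg : Continuous g) :
    ∑ σ ∈ Finset.univ.filter (fun σ : Equiv.Perm (Fin n) => Avoids321 σ),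
      Real.exp (n * ((∫ x, f x ∂(pi1 σ)) + ∫ x, g x ∂(pi2 σ))) ≤
    Real.exp (n * ((∫ x in Icc (0:ℝ) 1, softplus (f x)) + ∫ x in Icc (0:ℝ) 1, softplus (g x))) := by
  set G : Finset (Fin n) × Finset (Fin n) → ℝ := fun q =>
    Real.exp (n * ∫ x, f x ∂(cellMeasure q.1)) * Real.exp (n * ∫ x, g x ∂(cellMeasure q.2)) with hG
  set φ : Equiv.Perm (Fin n) → Finset (Fin n) × Finset (Fin n) := fun σ =>
    (RLMpositions σ, (RLMpositions σ).image σ) with hφ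
  have h1 : ∀ σ : Equiv.Perm (Fin n),
      Real.exp (n * ((∫ x, f x ∂(pi1 σ)) + ∫ x, g x ∂(pi2 σ))) = G (φ σ) := by
    intro σ
    rw [mul_add, Real.exp_add, pi1_eq_cellMeasure, pi2_eq_cellMeasure]
  have hinj : Set.InjOn φ
      (Finset.univ.filter (fun σ : Equiv.Perm (Fin n) => Avoids321 σ) : Finset _) := by
    intro σ hσ τ hτ h
    simp only [Finset.coe_filter, Finset.mem_univ, true_and, Set.mem_ofPred_eq] at hσ hτ
    exact hσ.ext hτ (congrArg Prod.fst h) (congrArg Prod.snd h)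
  calc _ = ∑ q ∈ (Finset.univ.filter
          (fun σ : Equiv.Perm (Fin n) => Avoids321 σ)).image φ, G q := by
        rw [Finset.sum_image hinj]
        exact Finset.sum_congr rfl fun σ _ => h1 σ
    _ ≤ ∑ q, G q := Finset.sum_le_sum_of_subset_of_nonneg (Finset.subset_univ _)
        fun q _ _ => by positivity
    _ = (∑ A : Finset (Fin n), Real.exp (n * ∫ x, f x ∂(cellMeasure A))) *
        ∑ A : Finset (Fin n), Real.exp (n * ∫ x, g x ∂(cellMeasure A)) := by
        rw [Fintype.sum_prod_type, Finset.sum_mul_sum]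
    _ ≤ _ := by
        rw [mul_add, Real.exp_add]
        exact mul_le_mul (sum_exp_integral_cellMeasure_le hn hf)
          (sum_exp_integral_cellMeasure_le hn hg)
          (Finset.sum_nonneg fun _ _ => (Real.exp_pos _).le) (Real.exp_pos _).le

end Cells

section Action

/-- The identity function truncated to `[0,1]`. -/
def clampFun : BoundedContinuousFunction ℝ ℝ :=
  BoundedContinuousFunction.ofNormedAddCommGroup (fun x => max 0 (min 1 x)) (by fun_prop) 1
    (fun x => by
      rw [Real.norm_of_nonneg (le_max_left _ _)]
      exact max_le zero_le_one (min_le_left _ _))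

lemma clampFun_of_mem {x : ℝ} (hx : x ∈ Icc (0:ℝ) 1) : clampFun x = x := by
  show max 0 (min 1 x) = x
  rw [min_eq_right hx.2, max_eq_right hx.1]

/-- The difference of the first moments of the two measures. -/
def momentDiff (p : Dspace) : ℝ :=
  ∫ x, clampFun x ∂(p.1.1 : Measure ℝ) - ∫ x, clampFun x ∂(p.1.2 : Measure ℝ)

lemma Dspace.continuous_integral_fst (f : BoundedContinuousFunction ℝ ℝ) :
    Continuous (fun p : Dspace => ∫ x, f x ∂(p.1.1 : Measure ℝ)) :=
  (FiniteMeasure.continuous_integral_boundedContinuousFunction f).comp Dspace.continuous_val_fst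

lemma Dspace.continuous_integral_snd (f : BoundedContinuousFunction ℝ ℝ) :
    Continuous (fun p : Dspace => ∫ x, f x ∂(p.1.2 : Measure ℝ)) :=
  (FiniteMeasure.continuous_integral_boundedContinuousFunction f).comp Dspace.continuous_val_snd

lemma continuous_momentDiff : Continuous momentDiff :=
  (Dspace.continuous_integral_fst _).sub (Dspace.continuous_integral_snd _)

lemma setIntegral_mul_dens {μ : FiniteMeasure ℝ} (h : (μ : Measure ℝ) ≤ Leb01) :
    ∫ x in Icc (0:ℝ) 1, x * dens μ x = ∫ x, clampFun x ∂(μ : Measure ℝ) := by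
  rw [← setIntegral_Icc_dens_mul h]
  refine setIntegral_congr_fun measurableSet_Icc fun x hx => ?_
  simp only [clampFun_of_mem hx]
  ring

lemma H321_eq (p : Dspace) :
    H321 p = 2 * Real.log 2 - densEntropy p.1.1 - densEntropy p.1.2 := by
  have h1 := integrableOn_binEntropy_dens p.2.1 (a := 0) (b := 1)
  have h2 := integrableOn_binEntropy_dens p.2.2.1 (a := 0) (b := 1)
  have h12 : IntegrableOn (fun x => Real.binEntropy (dens p.1.1 x) +
      Real.binEntropy (dens p.1.2 x)) (Icc 0 1) := h1.add h2
  have h3 : ∀ r, entTerm r = Real.log 2 - Real.binEntropy r := by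
    intro r
    rw [entTerm, Real.binEntropy, Real.log_inv, Real.log_inv]
    ring
  have h4 : ∀ x, entTerm (dens p.1.1 x) + entTerm (dens p.1.2 x) = 2 * Real.log 2 -
      (Real.binEntropy (dens p.1.1 x) + Real.binEntropy (dens p.1.2 x)) := by
    intro x; rw [h3, h3]; ring
  rw [H321]
  simp_rw [h4]
  rw [integral_sub (integrable_const _) h12, integral_add h1 h2, densEntropy, densEntropy]
  simp
  ring

lemma A321_eq (β : ℝ) (p : Dspace) : A321 β p =
    2 * Real.log 2 - densEntropy p.1.1 - densEntropy p.1.2 - β * momentDiff p := by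
  have hx : IntegrableOn (fun x : ℝ => x) (Icc 0 1) :=
    continuous_id.continuousOn.integrableOn_compact isCompact_Icc
  have h1 : IntegrableOn (fun x => x * dens p.1.1 x) (Icc 0 1) :=
    (integrableOn_dens_mul p.2.1 hx).congr_fun (fun x _ => mul_comm _ _) measurableSet_Icc
  have h2 : IntegrableOn (fun x => x * dens p.1.2 x) (Icc 0 1) :=
    (integrableOn_dens_mul p.2.2.1 hx).congr_fun (fun x _ => mul_comm _ _) measurableSet_Icc
  rw [A321, H321_eq, momentDiff, ← setIntegral_mul_dens p.2.1, ← setIntegral_mul_dens p.2.2.1,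
    ← integral_sub h1 h2]
  simp_rw [mul_sub]

lemma setIntegral_cell_clampFun {n : ℕ} (a : Fin n) :
    ∫ x in Icc (((a : ℕ) : ℝ) / n) ((((a : ℕ) : ℝ) + 1) / n), clampFun x =
      ((a : ℕ) + 1 / 2) / (n : ℝ) ^ 2 := by
  have hn : (0:ℝ) < n := by exact_mod_cast a.pos
  have ha : (((a : ℕ) : ℝ) + 1) ≤ n := by exact_mod_cast a.2
  rw [setIntegral_congr_fun (g := fun x => x) measurableSet_Icc, integral_Icc_eq_integral_Ioc,
    ← intervalIntegral.integral_of_le (by gcongr; simp), integral_id]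
  · field_simp
    ring
  · intro x hx
    exact clampFun_of_mem ⟨le_trans (by positivity) hx.1,
      hx.2.trans (by rwa [div_le_one hn])⟩

lemma momentDiff_of_avoids321 {n : ℕ} (hn : 0 < n) {σ : Equiv.Perm (Fin n)} (hσ : Avoids321 σ)
    {p : Dspace} (h1 : (p.1.1 : Measure ℝ) = pi1 σ) (h2 : (p.1.2 : Measure ℝ) = pi2 σ) :
    momentDiff p = invCount σ / (n : ℝ) ^ 2 := by
  have hn' : (0:ℝ) < n := by exact_mod_cast hn
  rw [momentDiff, h1, h2, pi1_eq_cellMeasure, pi2_eq_cellMeasure,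
    integral_cellMeasure _ clampFun.continuous, integral_cellMeasure _ clampFun.continuous,
    Finset.sum_image σ.injective.injOn]
  simp_rw [setIntegral_cell_clampFun]
  rw [← Finset.sum_div, ← Finset.sum_div, ← sub_div, Finset.sum_add_distrib,
    Finset.sum_add_distrib]
  congr 1
  have := congrArg (Nat.cast (R := ℝ)) hσ.invCount_add_sum
  push_cast at this
  linarith

/-- The action is, up to `ε`, bounded below by continuous functions with good exponential
moments. -/
lemma exists_continuous_minorant (β : ℝ) (p : Dspace) {ε : ℝ} (hε : 0 < ε) :
    ∃ Ψ : Dspace → ℝ, Continuous Ψ ∧ (∀ q, Ψ q ≤ A321 β q - 2 * Real.log 2) ∧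
      A321 β p - 2 * Real.log 2 ≤ Ψ p + ε ∧
      ∀ n : ℕ, 0 < n → ∀ P : Equiv.Perm (Fin n) → Dspace,
        (∀ σ, Avoids321 σ → ((P σ).1.1 : Measure ℝ) = pi1 σ ∧ ((P σ).1.2 : Measure ℝ) = pi2 σ) →
        ∑ σ ∈ Finset.univ.filter (fun σ : Equiv.Perm (Fin n) => Avoids321 σ),
          Real.exp (β / n * invCount σ + n * Ψ (P σ)) ≤ 1 := by
  obtain ⟨f, hf⟩ := exists_integral_softplus_le p.2.1 (half_pos hε)
  obtain ⟨g, hg⟩ := exists_integral_softplus_le p.2.2.1 (half_pos hε)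
  set C := (∫ x in Icc (0:ℝ) 1, softplus (f x)) + ∫ x in Icc (0:ℝ) 1, softplus (g x) with hC
  refine ⟨fun q => ∫ x, f x ∂(q.1.1 : Measure ℝ) + ∫ x, g x ∂(q.1.2 : Measure ℝ) - C -
    β * momentDiff q, ?_, ?_, ?_, ?_⟩
  · exact (((Dspace.continuous_integral_fst f).add (Dspace.continuous_integral_snd g)).sub
      continuous_const).sub (continuous_const.mul continuous_momentDiff)
  · intro q
    have h1 := integral_add_densEntropy_le q.2.1 f.continuous
    have h2 := integral_add_densEntropy_le q.2.2.1 g.continuous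
    rw [A321_eq]
    simp only
    linarith
  · rw [A321_eq]
    simp only
    linarith
  · intro n hn P hP
    have hn' : (0:ℝ) < n := by exact_mod_cast hn
    have h := sum_exp_avoids321_le hn f.continuous g.continuous
    calc _ = (∑ σ ∈ Finset.univ.filter (fun σ : Equiv.Perm (Fin n) => Avoids321 σ),
          Real.exp (n * ((∫ x, f x ∂(pi1 σ)) + ∫ x, g x ∂(pi2 σ)))) * Real.exp (-(n * C)) := by
          rw [Finset.sum_mul]
          refine Finset.sum_congr rfl fun σ hσ => ?_
          have hσ' : Avoids321 σ := (Finset.mem_filter.1 hσ).2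
          obtain ⟨e1, e2⟩ := hP σ hσ'
          show Real.exp (β / n * invCount σ + n * (∫ x, f x ∂((P σ).1.1 : Measure ℝ) +
            ∫ x, g x ∂((P σ).1.2 : Measure ℝ) - C - β * momentDiff (P σ))) = _
          rw [momentDiff_of_avoids321 hn hσ' e1 e2, e1, e2, ← Real.exp_add]
          congr 1
          field_simp
          ring
      _ ≤ Real.exp (n * C) * Real.exp (-(n * C)) :=
          mul_le_mul_of_nonneg_right h (Real.exp_pos _).le
      _ = 1 := by rw [← Real.exp_add, add_neg_cancel, Real.exp_zero]

end Action

section Binomial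

lemma log_factorial_le {n : ℕ} (hn : 1 ≤ n) :
    Real.log n.factorial ≤ n * Real.log n - n + Real.log n + 1 := by
  induction n, hn using Nat.le_induction with
  | base => simp
  | succ n hn ih =>
    have hn' : (0:ℝ) < n := by exact_mod_cast hn
    have h1 : Real.log ((n + 1).factorial : ℕ) = Real.log (n + 1 : ℕ) + Real.log n.factorial := by
      rw [Nat.factorial_succ, Nat.cast_mul, Real.log_mul (by positivity) (by positivity)]
    have h2 := Real.one_sub_inv_le_log_of_pos (x := ((n:ℝ) + 1) / n) (by positivity)
    rw [Real.log_div (by positivity) (by positivity)] at h2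
    have h3 : (1 - (((n:ℝ) + 1) / n)⁻¹) * (n + 1) = 1 := by field_simp; ring
    have h4 := mul_le_mul_of_nonneg_right h2 (by positivity : (0:ℝ) ≤ n + 1)
    rw [h3] at h4
    rw [h1]
    push_cast
    linarith

lemma le_log_choose {m a : ℕ} (hm : 1 ≤ m) (ha : a ≤ m) :
    m * Real.binEntropy (a / m) - 2 * Real.log m - 2 ≤ Real.log (m.choose a) := by
  have hm' : (0:ℝ) < m := by exact_mod_cast hm
  have key : ∀ b : ℕ, b ≤ m →
      Real.log b.factorial ≤ b * Real.log b - b + Real.log m + 1 := by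
    intro b hb
    rcases Nat.eq_zero_or_pos b with rfl | hb0
    · have := Real.log_nonneg (x := m) (by exact_mod_cast hm)
      simp
      linarith
    · have h1 := log_factorial_le hb0
      have h2 : Real.log b ≤ Real.log m :=
        Real.log_le_log (by exact_mod_cast hb0) (by exact_mod_cast hb)
      linarith
  have hlow : (m : ℝ) * Real.log m - m ≤ Real.log m.factorial := by
    have h := Stirling.le_log_factorial_stirling (n := m) (by omega)
    have := Real.log_nonneg (x := m) (by exact_mod_cast hm)
    have := Real.log_nonneg (x := 2 * Real.pi) (by linarith [Real.pi_gt_three])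
    linarith
  have hmul : ∀ b : ℕ, (b : ℝ) * Real.log (b / m) = b * Real.log b - b * Real.log m := by
    intro b
    rcases Nat.eq_zero_or_pos b with rfl | hb0
    · simp
    · rw [Real.log_div (by positivity) hm'.ne']
      ring
  have h1 := key a ha
  have h2 := key (m - a) (Nat.sub_le _ _)
  have h3 := hmul a
  have h4 := hmul (m - a)
  have hch : Real.log (m.choose a) =
      Real.log m.factorial - Real.log a.factorial - Real.log (m - a).factorial := by
    rw [← Nat.choose_mul_factorial_mul_factorial ha]
    have : ((m.choose a : ℕ) : ℝ) ≠ 0 := by exact_mod_cast (Nat.choose_pos ha).ne'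
    push_cast
    rw [Real.log_mul (by positivity) (by positivity), Real.log_mul this (by positivity)]
    ring
  rw [Nat.cast_sub ha] at h2 h4
  have h5 : (m : ℝ) * Real.binEntropy (a / m) =
      -(a * Real.log (a / m)) - (m - a) * Real.log ((m - a) / m) := by
    rw [Real.binEntropy, Real.log_inv, Real.log_inv]
    have : (1 - (a:ℝ) / m) = (m - a) / m := by field_simp
    rw [this]
    field_simp
    ring
  rw [hch, h5, h3, h4]
  linarith

end Binomial

section BlockFamily

/-- Sets of naturals whose numbers of elements below the thresholds `c i` are prescribed. -/
def blockFamily (c s : ℕ → ℕ) (K : ℕ) : Finset (Finset ℕ) :=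
  (Finset.Ico (c 0) (c K)).powerset.filter fun X => ∀ i ≤ K, (X.filter (· < c i)).card = s i

lemma subset_of_mem_blockFamily {c s : ℕ → ℕ} {K : ℕ} {X : Finset ℕ}
    (hX : X ∈ blockFamily c s K) : X ⊆ Finset.Ico (c 0) (c K) :=
  Finset.mem_powerset.1 (Finset.mem_filter.1 hX).1

lemma card_filter_of_mem_blockFamily {c s : ℕ → ℕ} {K : ℕ} {X : Finset ℕ}
    (hX : X ∈ blockFamily c s K) {i : ℕ} (hi : i ≤ K) : (X.filter (· < c i)).card = s i :=
  (Finset.mem_filter.1 hX).2 i hi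

lemma prod_choose_le_card_blockFamily {c s : ℕ → ℕ} (hc : Monotone c) (hs : Monotone s)
    (hs0 : s 0 = 0) (K : ℕ) :
    ∏ i ∈ Finset.range K, (c (i + 1) - c i).choose (s (i + 1) - s i) ≤
      (blockFamily c s K).card := by
  induction K with
  | zero =>
    have : ∅ ∈ blockFamily c s 0 := by simp [blockFamily, hs0]
    simpa using Finset.card_pos.2 ⟨_, this⟩
  | succ K ih =>
    set T := (Finset.Ico (c K) (c (K + 1))).powersetCard (s (K + 1) - s K)
    have hT : T.card = (c (K + 1) - c K).choose (s (K + 1) - s K) := by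
      rw [Finset.card_powersetCard, Nat.card_Ico]
    rw [Finset.prod_range_succ, ← hT]
    refine (Nat.mul_le_mul_right _ ih).trans ?_
    rw [← Finset.card_product]
    have hsplit : ∀ q ∈ blockFamily c s K ×ˢ T, ∀ x,
        (x ∈ q.1 → c 0 ≤ x ∧ x < c K) ∧ (x ∈ q.2 → c K ≤ x ∧ x < c (K + 1)) := by
      intro q hq x
      obtain ⟨h1, h2⟩ := Finset.mem_product.1 hq
      exact ⟨fun hx => Finset.mem_Ico.1 (subset_of_mem_blockFamily h1 hx),
        fun hx => Finset.mem_Ico.1 ((Finset.mem_powersetCard.1 h2).1 hx)⟩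
    refine Finset.card_le_card_of_injOn (fun q => q.1 ∪ q.2) ?_ ?_
    · intro q hq
      have hsp := hsplit q hq
      obtain ⟨h1, h2⟩ := Finset.mem_product.1 hq
      have hcK : c K ≤ c (K + 1) := hc (Nat.le_succ K)
      have hc0 : c 0 ≤ c K := hc (Nat.zero_le K)
      refine Finset.mem_filter.2 ⟨Finset.mem_powerset.2 fun x hx => ?_, fun i hi => ?_⟩
      · rw [Finset.mem_Ico]
        rcases Finset.mem_union.1 hx with h | h
        · have := (hsp x).1 h; omega
        · have := (hsp x).2 h; omega
      · rcases Nat.lt_or_ge K i with h | h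
        · obtain rfl : i = K + 1 := by omega
          have e1 : (q.1 ∪ q.2).filter (· < c (K + 1)) = q.1 ∪ q.2 := by
            refine Finset.filter_true_of_mem fun x hx => ?_
            rcases Finset.mem_union.1 hx with h | h
            · have := (hsp x).1 h; omega
            · have := (hsp x).2 h; omega
          have e2 : q.1.filter (· < c K) = q.1 :=
            Finset.filter_true_of_mem fun x hx => ((hsp x).1 hx).2
          have e3 := card_filter_of_mem_blockFamily h1 le_rfl
          rw [e2] at e3
          have hd : Disjoint q.1 q.2 := by
            rw [Finset.disjoint_left]
            intro x hx hx'
            have := (hsp x).1 hx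
            have := (hsp x).2 hx'
            omega
          simp only [e1]
          rw [Finset.card_union_of_disjoint hd, e3, (Finset.mem_powersetCard.1 h2).2]
          have : s K ≤ s (K + 1) := hs (Nat.le_succ K)
          omega
        · have e1 : (q.1 ∪ q.2).filter (· < c i) = q.1.filter (· < c i) := by
            ext x
            simp only [Finset.mem_filter, Finset.mem_union]
            constructor
            · rintro ⟨hx | hx, hlt⟩
              · exact ⟨hx, hlt⟩
              · have := ((hsp x).2 hx).1
                have := hc h
                omega
            · rintro ⟨hx, hlt⟩
              exact ⟨Or.inl hx, hlt⟩
          simp only [e1]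
          exact card_filter_of_mem_blockFamily h1 h
    · intro q hq r hr h
      have hsq := hsplit q hq
      have hsr := hsplit r hr
      have h' : ∀ x, (x ∈ q.1 ∨ x ∈ q.2) ↔ (x ∈ r.1 ∨ x ∈ r.2) := by
        intro x
        have := Finset.ext_iff.1 h x
        simpa only [Finset.mem_union] using this
      refine Prod.ext (Finset.ext fun x => ?_) (Finset.ext fun x => ?_)
      · have a1 := hsq x
        have a2 := hsr x
        have a3 := h' x
        by_cases hx : x < c K <;> constructor <;> intro hh <;> grind
      · have a1 := hsq x
        have a2 := hsr x
        have a3 := h' x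
        by_cases hx : x < c K <;> constructor <;> intro hh <;> grind

/-- The elements of `Fin n` whose value lies in a set of naturals. -/
def toFinSet (n : ℕ) (X : Finset ℕ) : Finset (Fin n) :=
  Finset.univ.filter fun x => (x : ℕ) ∈ X

lemma mem_toFinSet {n : ℕ} {X : Finset ℕ} {x : Fin n} : x ∈ toFinSet n X ↔ (x : ℕ) ∈ X := by
  simp [toFinSet]

lemma card_filter_toFinSet {n : ℕ} {X : Finset ℕ} (hX : ∀ x ∈ X, x < n) (P : ℕ → Prop)
    [DecidablePred P] : ((toFinSet n X).filter fun x : Fin n => P x).card = (X.filter P).card := by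
  refine Finset.card_bij (fun x _ => (x : ℕ)) ?_ ?_ ?_
  · intro x hx
    simpa only [Finset.mem_filter, mem_toFinSet] using hx
  · intro x _ y _ h
    exact Fin.ext h
  · intro y hy
    obtain ⟨h1, h2⟩ := Finset.mem_filter.1 hy
    exact ⟨⟨y, hX y h1⟩, by simp [mem_toFinSet, h1, h2], rfl⟩

lemma toFinSet_injOn {n : ℕ} : Set.InjOn (toFinSet n) {X | ∀ x ∈ X, x < n} := by
  intro X hX Y hY h
  ext x
  constructor
  · intro hx
    exact mem_toFinSet.1 (h ▸ mem_toFinSet.2 hx : (⟨x, hX x hx⟩ : Fin n) ∈ toFinSet n Y)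
  · intro hx
    exact mem_toFinSet.1 (h ▸ mem_toFinSet.2 hx : (⟨x, hY x hx⟩ : Fin n) ∈ toFinSet n X)

lemma exists_avoids321_of_blockFamily {n m K : ℕ} {s t : ℕ → ℕ} (hm : 0 < m)
    (hn : (K + 1) * m ≤ n) (hst : ∀ i, s i ≤ t i) (hK : s K = t K) {X Y : Finset ℕ}
    (hX : X ∈ blockFamily (fun i => (i + 1) * m) s K)
    (hY : Y ∈ blockFamily (fun i => i * m) t K) :
    ∃ σ : Equiv.Perm (Fin n), Avoids321 σ ∧ RLMpositions σ = toFinSet n X ∧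
      (RLMpositions σ).image σ = toFinSet n Y := by
  have hXm : ∀ x ∈ X, (0 + 1) * m ≤ x ∧ x < (K + 1) * m :=
    fun x hx => Finset.mem_Ico.1 (subset_of_mem_blockFamily hX hx)
  have hYm : ∀ x ∈ Y, 0 * m ≤ x ∧ x < K * m :=
    fun x hx => Finset.mem_Ico.1 (subset_of_mem_blockFamily hY hx)
  have hXn : ∀ x ∈ X, x < n := fun x hx => (hXm x hx).2.trans_le hn
  have hYn : ∀ x ∈ Y, x < n := fun x hx =>
    (hYm x hx).2.trans_le (le_trans (Nat.mul_le_mul_right _ (Nat.le_succ K)) hn)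
  have cX : ∀ i ≤ K, (X.filter (· < (i + 1) * m)).card = s i :=
    fun i hi => card_filter_of_mem_blockFamily hX hi
  have cY : ∀ i ≤ K, (Y.filter (· < i * m)).card = t i :=
    fun i hi => card_filter_of_mem_blockFamily hY hi
  apply exists_avoids321
  · have e1 := card_filter_toFinSet hXn (· < (K + 1) * m)
    have e2 := card_filter_toFinSet hYn (· < K * m)
    rw [cX K le_rfl, Finset.filter_true_of_mem
      fun (x : Fin n) hx => (hXm x (mem_toFinSet.1 hx)).2] at e1
    rw [cY K le_rfl, Finset.filter_true_of_mem
      fun (x : Fin n) hx => (hYm x (mem_toFinSet.1 hx)).2] at e2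
    rw [e1, e2, hK]
  · intro x
    have e1 := card_filter_toFinSet hXn (· ≤ (x : ℕ))
    have e2 := card_filter_toFinSet hYn (· < (x : ℕ))
    have hx1 : (x : ℕ) < ((x : ℕ) / m + 1) * m := Nat.lt_mul_of_div_lt (Nat.lt_succ_self _) hm
    have hx2 : (x : ℕ) / m * m ≤ x := Nat.div_mul_le_self _ _
    set j := min ((x : ℕ) / m) K with hj
    have hjK : j ≤ K := min_le_right _ _
    calc _ = (X.filter (· ≤ (x : ℕ))).card := e1
      _ ≤ (X.filter (· < (j + 1) * m)).card := by
        refine Finset.card_le_card fun y hy => ?_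
        obtain ⟨h1, h2⟩ := Finset.mem_filter.1 hy
        refine Finset.mem_filter.2 ⟨h1, ?_⟩
        rcases min_choice ((x : ℕ) / m) K with h | h <;> rw [hj, h]
        · exact h2.trans_lt hx1
        · exact (hXm y h1).2
      _ = s j := cX j hjK
      _ ≤ t j := hst j
      _ = (Y.filter (· < j * m)).card := (cY j hjK).symm
      _ ≤ (Y.filter (· < (x : ℕ))).card := by
        refine Finset.card_le_card fun y hy => ?_
        obtain ⟨h1, h2⟩ := Finset.mem_filter.1 hy
        exact Finset.mem_filter.2 ⟨h1, h2.trans_le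
          ((Nat.mul_le_mul_right _ (min_le_left _ _)).trans hx2)⟩
      _ = _ := e2.symm

end BlockFamily

section Discretization

open scoped Topology

lemma real_cellMeasure_Icc {n : ℕ} (hn : 0 < n) (A : Finset (Fin n)) (k : ℕ) :
    (cellMeasure A).real (Icc 0 ((k : ℝ) / n)) =
      (A.filter fun x : Fin n => (x : ℕ) < k).card / (n : ℝ) := by
  have hn' : (0:ℝ) < n := by exact_mod_cast hn
  have h : ∀ a : Fin n, (volume.restrict
      (Icc (((a : ℕ) : ℝ) / n) ((((a : ℕ) : ℝ) + 1) / n))) (Icc 0 ((k : ℝ) / n)) =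
      if (a : ℕ) < k then ENNReal.ofReal (1 / n) else 0 := by
    intro a
    rw [Measure.restrict_apply measurableSet_Icc]
    split_ifs with h
    · have h' : ((a : ℕ) : ℝ) + 1 ≤ k := by exact_mod_cast h
      rw [inter_eq_self_of_subset_right, Real.volume_Icc]
      · congr 1
        field_simp
        ring
      · refine Icc_subset_Icc (by positivity) (by gcongr)
    · have h' : (k : ℝ) ≤ (a : ℕ) := by exact_mod_cast not_lt.1 h
      refine measure_mono_null (t := {((a : ℕ) : ℝ) / n}) ?_ (by simp)
      rintro x ⟨h1, h2⟩
      exact le_antisymm (h1.2.trans (by gcongr)) h2.1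
  rw [Measure.real, cellMeasure, Measure.finsetSum_apply]
  simp_rw [h]
  rw [← Finset.sum_filter, Finset.sum_const, nsmul_eq_mul, ENNReal.toReal_mul,
    ENNReal.toReal_natCast, ENNReal.toReal_ofReal (by positivity), mul_one_div]

lemma abs_real_Icc_sub_le {ν : Measure ℝ} (h : ν ≤ Leb01) (x y : ℝ) :
    |ν.real (Icc 0 x) - ν.real (Icc 0 y)| ≤ |x - y| := by
  have : IsFiniteMeasure ν := isFiniteMeasure_of_le _ h
  rcases le_total x y with e | e
  · rw [abs_sub_comm, abs_sub_comm x y, abs_of_nonneg (sub_nonneg.2 e),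
      abs_of_nonneg (sub_nonneg.2 (real_Icc_mono e))]
    exact real_Icc_sub_le_of_le_Leb01 h e
  · rw [abs_of_nonneg (sub_nonneg.2 e), abs_of_nonneg (sub_nonneg.2 (real_Icc_mono e))]
    exact real_Icc_sub_le_of_le_Leb01 h e

/-- Number of points that the first `i` of `K` blocks of size `m` should receive in order to
approximate `μ`. -/
def blockCount (μ : FiniteMeasure ℝ) (K m i : ℕ) : ℕ :=
  ⌊(m : ℝ) * (K * (μ : Measure ℝ).real (Icc 0 ((i : ℝ) / K)))⌋₊

lemma monotone_blockCount (μ : FiniteMeasure ℝ) (K m : ℕ) : Monotone (blockCount μ K m) := by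
  intro i j hij
  have h : (μ : Measure ℝ).real (Icc 0 ((i : ℝ) / K)) ≤ (μ : Measure ℝ).real (Icc 0 ((j : ℝ) / K)) :=
    real_Icc_mono (by gcongr)
  exact Nat.floor_mono (by gcongr)

lemma blockCount_zero {μ : FiniteMeasure ℝ} (h : (μ : Measure ℝ) ≤ Leb01) (K m : ℕ) :
    blockCount μ K m 0 = 0 := by
  rw [blockCount, real_Icc_nonpos h (by simp)]
  simp

lemma blockCount_le_of_dspace (p : Dspace) (K m i : ℕ) :
    blockCount p.1.1 K m i ≤ blockCount p.1.2 K m i := by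
  apply Nat.floor_mono
  gcongr
  exact ENNReal.toReal_mono (measure_ne_top _ _) (p.2.2.2.2 _)

lemma blockCount_eq_of_dspace (p : Dspace) {K : ℕ} (hK : 0 < K) (m : ℕ) :
    blockCount p.1.1 K m K = blockCount p.1.2 K m K := by
  have h : (K : ℝ) / K = 1 := div_self (by exact_mod_cast hK.ne')
  rw [blockCount, blockCount, h, Measure.real, Measure.real,
    ← measure_univ_of_le_Leb01 p.2.1 le_rfl, ← measure_univ_of_le_Leb01 p.2.2.1 le_rfl, p.2.2.2.1]

lemma blockCount_succ_sub_le {μ : FiniteMeasure ℝ} (h : (μ : Measure ℝ) ≤ Leb01) {K : ℕ}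
    (hK : 0 < K) (m i : ℕ) : blockCount μ K m (i + 1) - blockCount μ K m i ≤ m := by
  have hK' : (0:ℝ) < K := by exact_mod_cast hK
  rw [tsub_le_iff_left, blockCount, blockCount, ← Nat.floor_add_natCast (by positivity)]
  apply Nat.floor_mono
  have h1 := real_Icc_sub_le_of_le_Leb01 h (x := (i : ℝ) / K) (y := ((i + 1 : ℕ) : ℝ) / K)
    (by gcongr; simp)
  have h2 : ((i + 1 : ℕ) : ℝ) / K - (i : ℝ) / K = 1 / K := by push_cast; ring
  rw [h2, le_div_iff₀ hK'] at h1
  have := mul_le_mul_of_nonneg_left h1 (by positivity : (0:ℝ) ≤ m)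
  linarith

lemma abs_real_Icc_sub_le_of_blockCount {μ : FiniteMeasure ℝ} (hμ : (μ : Measure ℝ) ≤ Leb01)
    {ν : Measure ℝ} (hν : ν ≤ Leb01) {K n o : ℕ} (hK : 0 < K) (hn : K ^ 2 ≤ n) (ho : o ≤ 1)
    (h : ∀ i ≤ K, ν.real (Icc 0 ((((i + o) * (n / (K + 1)) : ℕ) : ℝ) / n)) =
      blockCount μ K (n / (K + 1)) i / n) {x : ℝ} (hx : x ∈ Icc (0:ℝ) 1) :
    |ν.real (Icc 0 x) - (μ : Measure ℝ).real (Icc 0 x)| ≤ 7 / K := by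
  have hK' : (1:ℝ) ≤ K := by exact_mod_cast hK
  have hn0 : 0 < n := lt_of_lt_of_le (by positivity) hn
  have hn' : (0:ℝ) < n := by exact_mod_cast hn0
  have hnK : (K:ℝ) ^ 2 ≤ n := by exact_mod_cast hn
  have hoR : (o : ℝ) ≤ 1 := by exact_mod_cast ho
  set m := n / (K + 1) with hm
  have hm1 : (m : ℝ) * (K + 1) ≤ n := by exact_mod_cast Nat.div_mul_le_self n (K + 1)
  have hm2 : (n : ℝ) ≤ (m + 1) * (K + 1) := by
    have : n < (K + 1) * (m + 1) := Nat.lt_mul_div_succ n (Nat.succ_pos K)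
    have : (n : ℝ) < (K + 1) * (m + 1) := by exact_mod_cast this
    linarith
  set i := ⌊(K : ℝ) * x⌋₊ with hi
  have hi1 : (i : ℝ) ≤ K * x := Nat.floor_le (by have := hx.1; positivity)
  have hi2 : (K : ℝ) * x < i + 1 := Nat.lt_floor_add_one _
  have hiK' : (i : ℝ) ≤ K := hi1.trans (mul_le_of_le_one_right (by positivity) hx.2)
  have hiK : i ≤ K := by exact_mod_cast hiK'
  have hinv : (K : ℝ) / n ≤ 1 / K := by
    rw [div_le_div_iff₀ hn' (by positivity)]
    nlinarith
  have hinv1 : (1 : ℝ) / n ≤ 1 / K := by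
    refine le_trans ?_ hinv
    gcongr
  have e1 : |(μ : Measure ℝ).real (Icc 0 ((i : ℝ) / K)) - (μ : Measure ℝ).real (Icc 0 x)| ≤
      1 / K := by
    refine (abs_real_Icc_sub_le hμ _ _).trans ?_
    rw [abs_le]
    have a1 : (i : ℝ) / K ≤ x := by rw [div_le_iff₀ (by positivity)]; linarith
    have a2 : x ≤ (i : ℝ) / K + 1 / K := by
      rw [← add_div, le_div_iff₀ (by positivity)]; linarith
    have a3 : 0 < 1 / (K : ℝ) := by positivity
    constructor <;> linarith
  have hq1 : (m : ℝ) / n ≤ 1 / (K + 1) := by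
    rw [div_le_div_iff₀ hn' (by positivity)]; linarith
  have hq2 : 1 / ((K : ℝ) + 1) - 1 / n ≤ m / n := by
    rw [sub_le_iff_le_add, ← add_div, div_le_div_iff₀ (by positivity) hn']; linarith
  have hK1 : 1 / ((K : ℝ) + 1) ≤ 1 / K := by gcongr; linarith
  have hKK : (K : ℝ) * (1 / (K + 1)) = 1 - 1 / (K + 1) := by field_simp; ring
  have e2 : |ν.real (Icc 0 x) - blockCount μ K m i / n| ≤ 3 / K := by
    rw [← h i hiK]
    refine (abs_real_Icc_sub_le hν _ _).trans ?_
    push_cast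
    have a0 : 1 / (K : ℝ) * K = 1 := by field_simp
    have a1 : ((i : ℝ) + o) * m / n = (i + o) * (m / n) := by ring
    have hx3 : x ≤ (i + 1) * (1 / K) := by
      rw [mul_one_div, le_div_iff₀ (by positivity)]; linarith
    have hx4 : i * (1 / K) ≤ x := by
      rw [mul_one_div, div_le_iff₀ (by positivity)]; linarith
    have hdiff : 1 / (K : ℝ) - 1 / (K + 1) = (1 / K) * (1 / (K + 1)) := by field_simp; ring
    have b1 : ((i : ℝ) + o) * (m / n) ≤ (i + 1) * (1 / K) :=
      mul_le_mul (by linarith) (hq1.trans hK1) (by positivity) (by positivity)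
    have b2 : (i : ℝ) * (m / n) ≤ (i + o) * (m / n) := by gcongr; simp
    have b3 : (i : ℝ) * (1 / (K + 1) - 1 / n) ≤ i * (m / n) := by gcongr
    have b4 : (i : ℝ) * (1 / n) ≤ K * (1 / n) := by gcongr
    have b5 : (i : ℝ) * ((1 / K) * (1 / (K + 1))) ≤ K * ((1 / K) * (1 / (K + 1))) := by gcongr
    have b6 : (K : ℝ) * ((1 / K) * (1 / (K + 1))) = 1 / (K + 1) := by field_simp
    have b7 : (K : ℝ) * (1 / n) = K / n := by ring
    have b8 : (i : ℝ) * (1 / (K + 1)) = i * (1 / K) - i * ((1 / K) * (1 / (K + 1))) := by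
      rw [← hdiff]; ring
    have b9 : (3 : ℝ) / K = 3 * (1 / K) := by ring
    rw [a1, b9, abs_le]
    have hpos : 0 < 1 / (K : ℝ) := by positivity
    constructor
    · linarith
    · linarith
  have e3 : |blockCount μ K m i / n - (μ : Measure ℝ).real (Icc 0 ((i : ℝ) / K))| ≤ 3 / K := by
    set F := (μ : Measure ℝ).real (Icc 0 ((i : ℝ) / K)) with hF
    have hF0 : 0 ≤ F := measureReal_nonneg
    have hF1 : F ≤ 1 := real_Icc_le_one hμ _
    have c1 : (blockCount μ K m i : ℝ) ≤ m * (K * F) := Nat.floor_le (by positivity)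
    have c2 : (m : ℝ) * (K * F) < blockCount μ K m i + 1 := Nat.lt_floor_add_one _
    have d1 : (blockCount μ K m i : ℝ) / n ≤ (m / n) * K * F := by
      rw [div_mul_eq_mul_div, div_mul_eq_mul_div]
      gcongr
      linarith
    have d2 : (m / n) * K * F ≤ (blockCount μ K m i : ℝ) / n + 1 / n := by
      rw [div_mul_eq_mul_div, div_mul_eq_mul_div, ← add_div]
      gcongr
      linarith
    have d3 : (m : ℝ) / n * K ≤ 1 := by
      calc (m : ℝ) / n * K ≤ 1 / (K + 1) * K := by gcongr
        _ ≤ 1 := by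
          have : (0:ℝ) < 1 / (K + 1) := by positivity
          linarith
    have d4 : (1 / ((K : ℝ) + 1) - 1 / n) * K ≤ (m : ℝ) / n * K := by gcongr
    have d5 : (1 - (m : ℝ) / n * K) * F ≤ (1 - (m : ℝ) / n * K) * 1 := by
      gcongr
    have d6 : (m : ℝ) / n * K * F ≤ 1 * F := by gcongr
    have d7 : 1 / (n : ℝ) * K = K / n := by ring
    have d8 : (3 : ℝ) / K = 3 * (1 / K) := by ring
    rw [d8, abs_le]
    constructor
    · linarith
    · have : 0 < 1 / (K : ℝ) := by positivity
      linarith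
  have h7 : (7 : ℝ) / K = 3 / K + 3 / K + 1 / K := by ring
  have := abs_le.1 e1
  have := abs_le.1 e2
  have := abs_le.1 e3
  rw [h7, abs_le]
  constructor <;> linarith

/-- A neighbourhood of a point of `Dspace` contains all points with uniformly close distribution
functions. -/
lemma Dspace.exists_forall_mem_of_abs_le {p : Dspace} {O : Set Dspace} (hO : O ∈ 𝓝 p) :
    ∃ δ > 0, ∀ q : Dspace,
      (∀ x ∈ Icc (0:ℝ) 1, |(q.1.1 : Measure ℝ).real (Icc 0 x) -
        (p.1.1 : Measure ℝ).real (Icc 0 x)| ≤ δ ∧ |(q.1.2 : Measure ℝ).real (Icc 0 x) -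
        (p.1.2 : Measure ℝ).real (Icc 0 x)| ≤ δ) → q ∈ O := by
  by_contra! hcon
  choose q hq hqO using fun N : ℕ => hcon (1 / ((N : ℝ) + 1)) Nat.one_div_pos_of_nat
  have hlim : Tendsto q atTop (𝓝 p) := by
    refine Dspace.tendsto_of_tendsto ?_ ?_
    · refine tendsto_of_tendsto_real_Icc (fun i => (q i).2.1) p.2.1 fun x hx => ?_
      rw [tendsto_iff_dist_tendsto_zero]
      exact squeeze_zero (fun _ => dist_nonneg) (fun i => (hq i x hx).1)
        tendsto_one_div_add_atTop_nhds_zero_nat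
    · refine tendsto_of_tendsto_real_Icc (fun i => (q i).2.2.1) p.2.2.1 fun x hx => ?_
      rw [tendsto_iff_dist_tendsto_zero]
      exact squeeze_zero (fun _ => dist_nonneg) (fun i => (hq i x hx).2)
        tendsto_one_div_add_atTop_nhds_zero_nat
  obtain ⟨N, hN⟩ := (hlim.eventually hO).exists
  exact hqO N hN

end Discretization

section BlockEntropy

open scoped Topology

/-- Rescaled mass of the `i`-th of `K` blocks of `[0,1]`. -/
def blockDensity (μ : FiniteMeasure ℝ) (K i : ℕ) : ℝ :=
  K * (μ : Measure ℝ).real (Icc 0 (((i + 1 : ℕ) : ℝ) / K)) -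
    K * (μ : Measure ℝ).real (Icc 0 ((i : ℝ) / K))

lemma setIntegral_binEntropy_dens_le {μ : FiniteMeasure ℝ} (h : (μ : Measure ℝ) ≤ Leb01) {K : ℕ}
    (hK : 0 < K) (i : ℕ) :
    ∫ x in Ioc ((i : ℝ) / K) (((i + 1 : ℕ) : ℝ) / K), Real.binEntropy (dens μ x) ≤
      1 / K * Real.binEntropy (blockDensity μ K i) := by
  have hK' : (0:ℝ) < K := by exact_mod_cast hK
  set I := Ioc ((i : ℝ) / K) (((i + 1 : ℕ) : ℝ) / K) with hI
  have hle : (i : ℝ) / K ≤ ((i + 1 : ℕ) : ℝ) / K := by gcongr; simp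
  have hvol : volume I = ENNReal.ofReal (1 / K) := by
    rw [Real.volume_Ioc]
    congr 1
    push_cast
    ring
  have hvol' : volume.real I = 1 / K := by
    rw [Measure.real, hvol, ENNReal.toReal_ofReal (by positivity)]
  have hJ := Real.strictConcave_binEntropy.concaveOn.le_map_set_average
    (μ := volume) (t := I) (f := dens μ) Real.binEntropy_continuous.continuousOn isClosed_Icc
    (by rw [hvol]; simp [hK]) (by rw [hvol]; exact ENNReal.ofReal_ne_top)
    (by
      apply ae_restrict_of_ae
      filter_upwards [dens_le_one h] with x hx
      exact ⟨dens_nonneg _ _, hx⟩)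
    ((integrableOn_dens h).mono_set Ioc_subset_Icc_self)
    ((integrableOn_binEntropy_dens h).mono_set Ioc_subset_Icc_self)
  have hdens : ∫ x in I, dens μ x = (μ : Measure ℝ).real I := by
    have := setIntegral_dens_mul h (s := I) measurableSet_Ioc (fun _ => 1)
    simpa using this
  rw [setAverage_eq, setAverage_eq, hvol', hdens, hI, real_Ioc_of_nonneg (by positivity) hle,
    smul_eq_mul, smul_eq_mul, one_div, inv_inv] at hJ
  rw [blockDensity, ← mul_sub, one_div, le_inv_mul_iff₀ hK']
  exact hJ

lemma densEntropy_le_sum_binEntropy {μ : FiniteMeasure ℝ} (h : (μ : Measure ℝ) ≤ Leb01) {K : ℕ}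
    (hK : 0 < K) :
    densEntropy μ ≤ 1 / K * ∑ i ∈ Finset.range K, Real.binEntropy (blockDensity μ K i) := by
  have hK' : (0:ℝ) < K := by exact_mod_cast hK
  have h_int : ∀ a b : ℝ, a ≤ b → IntervalIntegrable (fun x => Real.binEntropy (dens μ x))
      volume a b := fun a b hab =>
    (intervalIntegrable_iff_integrableOn_Icc_of_le hab).2 (integrableOn_binEntropy_dens h)
  have h2 := intervalIntegral.sum_integral_adjacent_intervals
    (f := fun x => Real.binEntropy (dens μ x)) (μ := volume)
    (a := fun k : ℕ => (k : ℝ) / K) (n := K) (fun k _ => h_int _ _ (by gcongr; simp))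
  simp only [CharP.cast_eq_zero, zero_div, div_self hK'.ne'] at h2
  rw [densEntropy, integral_Icc_eq_integral_Ioc, ← intervalIntegral.integral_of_le zero_le_one,
    ← h2, Finset.mul_sum]
  refine Finset.sum_le_sum fun i _ => ?_
  rw [intervalIntegral.integral_of_le (by gcongr; simp)]
  exact setIntegral_binEntropy_dens_le h hK i

lemma tendsto_blockCount_sub_div (μ : FiniteMeasure ℝ) (K i : ℕ) :
    Tendsto (fun m : ℕ => ((blockCount μ K m (i + 1) - blockCount μ K m i : ℕ) : ℝ) / m) atTop
      (𝓝 (blockDensity μ K i)) := by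
  have h : ∀ j, Tendsto (fun m : ℕ => (blockCount μ K m j : ℝ) / m) atTop
      (𝓝 (K * (μ : Measure ℝ).real (Icc 0 ((j : ℝ) / K)))) := by
    intro j
    have := (tendsto_nat_floor_mul_div_atTop (R := ℝ)
      (a := K * (μ : Measure ℝ).real (Icc 0 ((j : ℝ) / K))) (by positivity)).comp
      tendsto_natCast_atTop_atTop
    refine this.congr fun m => ?_
    rw [Function.comp_apply, blockCount, mul_comm (m : ℝ)]
  refine ((h (i + 1)).sub (h i)).congr fun m => ?_
  rw [Nat.cast_sub (monotone_blockCount μ K m (Nat.le_succ i)), sub_div]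

/-- Number of ways of choosing the prescribed numbers of points in each block. -/
def blockWays (μ : FiniteMeasure ℝ) (K m : ℕ) : ℕ :=
  ∏ i ∈ Finset.range K, m.choose (blockCount μ K m (i + 1) - blockCount μ K m i)

lemma blockWays_pos {μ : FiniteMeasure ℝ} (h : (μ : Measure ℝ) ≤ Leb01) {K : ℕ} (hK : 0 < K)
    (m : ℕ) : 0 < blockWays μ K m :=
  Finset.prod_pos fun i _ => Nat.choose_pos (blockCount_succ_sub_le h hK m i)

lemma eventually_le_log_blockWays {μ : FiniteMeasure ℝ} (h : (μ : Measure ℝ) ≤ Leb01) {K : ℕ}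
    (hK : 0 < K) {ε : ℝ} (hε : 0 < ε) :
    ∀ᶠ m : ℕ in atTop, m * (K * densEntropy μ - ε) ≤ Real.log (blockWays μ K m) := by
  have hK' : (0:ℝ) < K := by exact_mod_cast hK
  have hlog : Tendsto (fun m : ℕ => Real.log m / m) atTop (𝓝 0) :=
    (Real.isLittleO_log_id_atTop.tendsto_div_nhds_zero).comp tendsto_natCast_atTop_atTop
  have hinv : Tendsto (fun m : ℕ => 1 / (m : ℝ)) atTop (𝓝 0) := tendsto_one_div_atTop_nhds_zero_nat
  have hlim : Tendsto (fun m : ℕ => ∑ i ∈ Finset.range K,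
      (Real.binEntropy (((blockCount μ K m (i + 1) - blockCount μ K m i : ℕ) : ℝ) / m) -
        2 * (Real.log m / m) - 2 * (1 / m))) atTop
      (𝓝 (∑ i ∈ Finset.range K, (Real.binEntropy (blockDensity μ K i) - 2 * 0 - 2 * 0))) :=
    tendsto_finsetSum _ fun i _ =>
      (((Real.binEntropy_continuous.tendsto _).comp (tendsto_blockCount_sub_div μ K i)).sub
        (hlog.const_mul 2)).sub (hinv.const_mul 2)
  have hle : K * densEntropy μ ≤
      ∑ i ∈ Finset.range K, (Real.binEntropy (blockDensity μ K i) - 2 * 0 - 2 * 0) := by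
    have := densEntropy_le_sum_binEntropy h hK
    rw [one_div, le_inv_mul_iff₀ hK'] at this
    simpa using this
  filter_upwards [hlim.eventually_const_lt (show K * densEntropy μ - ε < _ by linarith),
    eventually_ge_atTop 1] with m hm hm1
  have hm' : (0:ℝ) < m := by exact_mod_cast hm1
  rw [blockWays, Nat.cast_prod, Real.log_prod]
  · refine (mul_le_mul_of_nonneg_left hm.le hm'.le).trans ?_
    rw [Finset.mul_sum]
    refine Finset.sum_le_sum fun i _ => ?_
    refine le_trans (le_of_eq ?_) (le_log_choose hm1 (blockCount_succ_sub_le h hK m i))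
    field_simp
  · intro i _
    exact_mod_cast (Nat.choose_pos (blockCount_succ_sub_le h hK m i)).ne'

end BlockEntropy

section Counting

open scoped Topology

lemma tendsto_nat_div_atTop {K : ℕ} : Tendsto (fun n : ℕ => n / (K + 1)) atTop atTop :=
  Nat.tendsto_div_const_atTop (Nat.succ_ne_zero K)

lemma blockWays_mul_le_card {Pi : ∀ n : ℕ, Equiv.Perm (Fin n) → Dspace}
    (hPi : ∀ n : ℕ, 1 ≤ n → ∀ σ : Equiv.Perm (Fin n), Avoids321 σ →
      ((Pi n σ).1.1 : Measure ℝ) = pi1 σ ∧ ((Pi n σ).1.2 : Measure ℝ) = pi2 σ)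
    {p : Dspace} {O : Set Dspace} {K n : ℕ} (hK : 0 < K) (hn : K ^ 2 ≤ n) (hKn : K + 1 ≤ n)
    (hO : ∀ q : Dspace, (∀ x ∈ Icc (0:ℝ) 1, |(q.1.1 : Measure ℝ).real (Icc 0 x) -
        (p.1.1 : Measure ℝ).real (Icc 0 x)| ≤ 7 / K ∧ |(q.1.2 : Measure ℝ).real (Icc 0 x) -
        (p.1.2 : Measure ℝ).real (Icc 0 x)| ≤ 7 / K) → q ∈ O) :
    blockWays p.1.1 K (n / (K + 1)) * blockWays p.1.2 K (n / (K + 1)) ≤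
      (Finset.univ.filter fun σ : Equiv.Perm (Fin n) => Avoids321 σ ∧ Pi n σ ∈ O).card := by
  set m := n / (K + 1) with hm
  have hm0 : 0 < m := Nat.div_pos hKn (Nat.succ_pos K)
  have hmn : (K + 1) * m ≤ n := Nat.mul_div_le n (K + 1)
  have hn0 : 0 < n := lt_of_lt_of_le (Nat.succ_pos K) hKn
  set s := blockCount p.1.1 K m with hs
  set t := blockCount p.1.2 K m with ht
  set 𝒳 := blockFamily (fun i => (i + 1) * m) s K with h𝒳
  set 𝒴 := blockFamily (fun i => i * m) t K with h𝒴
  have hX : blockWays p.1.1 K m ≤ 𝒳.card := by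
    refine le_trans (le_of_eq ?_) (prod_choose_le_card_blockFamily
      (fun i j hij => Nat.mul_le_mul_right _ (Nat.succ_le_succ hij))
      (monotone_blockCount _ _ _) (blockCount_zero p.2.1 K m) K)
    refine Finset.prod_congr rfl fun i _ => ?_
    congr 1
    show m = (i + 1 + 1) * m - (i + 1) * m
    rw [← Nat.sub_mul]
    simp
  have hY : blockWays p.1.2 K m ≤ 𝒴.card := by
    refine le_trans (le_of_eq ?_) (prod_choose_le_card_blockFamily
      (fun i j hij => Nat.mul_le_mul_right _ hij)
      (monotone_blockCount _ _ _) (blockCount_zero p.2.2.1 K m) K)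
    refine Finset.prod_congr rfl fun i _ => ?_
    congr 1
    show m = (i + 1) * m - i * m
    rw [← Nat.sub_mul]
    simp
  refine (Nat.mul_le_mul hX hY).trans ?_
  rw [← Finset.card_product]
  have hXn : ∀ X ∈ 𝒳, ∀ x ∈ X, x < n := fun X hX x hx =>
    (Finset.mem_Ico.1 (subset_of_mem_blockFamily hX hx)).2.trans_le hmn
  have hYn : ∀ Y ∈ 𝒴, ∀ x ∈ Y, x < n := fun Y hY x hx =>
    (Finset.mem_Ico.1 (subset_of_mem_blockFamily hY hx)).2.trans_le
      ((Nat.mul_le_mul_right _ (Nat.le_succ K)).trans hmn)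
  have hex : ∀ q : Finset ℕ × Finset ℕ, ∃ σ : Equiv.Perm (Fin n), q ∈ 𝒳 ×ˢ 𝒴 →
      Avoids321 σ ∧ RLMpositions σ = toFinSet n q.1 ∧
        (RLMpositions σ).image σ = toFinSet n q.2 := by
    intro q
    by_cases hq : q ∈ 𝒳 ×ˢ 𝒴
    · obtain ⟨h1, h2⟩ := Finset.mem_product.1 hq
      obtain ⟨σ, hσ⟩ := exists_avoids321_of_blockFamily hm0 hmn
        (blockCount_le_of_dspace p K m) (blockCount_eq_of_dspace p hK m) h1 h2
      exact ⟨σ, fun _ => hσ⟩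
    · exact ⟨1, fun h => absurd h hq⟩
  choose φ hφ using hex
  refine Finset.card_le_card_of_injOn φ ?_ ?_
  · intro q hq
    obtain ⟨hσ, hA, hB⟩ := hφ q hq
    obtain ⟨h1, h2⟩ := Finset.mem_product.1 hq
    refine Finset.mem_filter.2 ⟨Finset.mem_univ _, hσ, hO _ ?_⟩
    obtain ⟨e1, e2⟩ := hPi n hn0 _ hσ
    have l1 := (Pi n (φ q)).2.1
    have l2 := (Pi n (φ q)).2.2.1
    rw [e1] at l1
    rw [e2] at l2
    rw [e1, e2]
    intro x hx
    refine ⟨abs_real_Icc_sub_le_of_blockCount p.2.1 l1 hK hn (o := 1) le_rfl ?_ hx,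
      abs_real_Icc_sub_le_of_blockCount p.2.2.1 l2 hK hn (o := 0) zero_le_one ?_ hx⟩
    · intro i hi
      rw [pi1_eq_cellMeasure, hA, real_cellMeasure_Icc hn0,
        card_filter_toFinSet (hXn _ h1) (· < (i + 1) * m)]
      exact congrArg (fun k : ℕ => (k : ℝ) / n) (card_filter_of_mem_blockFamily h1 hi)
    · intro i hi
      rw [pi2_eq_cellMeasure, hB, real_cellMeasure_Icc hn0,
        card_filter_toFinSet (hYn _ h2) (· < (i + 0) * m)]
      exact congrArg (fun k : ℕ => (k : ℝ) / n) (card_filter_of_mem_blockFamily h2 hi)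
  · intro q hq r hr h
    obtain ⟨-, hA, hB⟩ := hφ q hq
    obtain ⟨-, hA', hB'⟩ := hφ r hr
    obtain ⟨h1, h2⟩ := Finset.mem_product.1 hq
    obtain ⟨h1', h2'⟩ := Finset.mem_product.1 hr
    rw [h] at hA hB
    exact Prod.ext (toFinSet_injOn (hXn _ h1) (hXn _ h1') (hA.symm.trans hA'))
      (toFinSet_injOn (hYn _ h2) (hYn _ h2') (hB.symm.trans hB'))

lemma eventually_exp_le_card {Pi : ∀ n : ℕ, Equiv.Perm (Fin n) → Dspace}
    (hPi : ∀ n : ℕ, 1 ≤ n → ∀ σ : Equiv.Perm (Fin n), Avoids321 σ →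
      ((Pi n σ).1.1 : Measure ℝ) = pi1 σ ∧ ((Pi n σ).1.2 : Measure ℝ) = pi2 σ)
    {p : Dspace} {O : Set Dspace} (hO : O ∈ 𝓝 p) {ε : ℝ} (hε : 0 < ε) :
    ∀ᶠ n : ℕ in atTop, Real.exp (n * (densEntropy p.1.1 + densEntropy p.1.2 - ε)) ≤
      (Finset.univ.filter fun σ : Equiv.Perm (Fin n) => Avoids321 σ ∧ Pi n σ ∈ O).card := by
  obtain ⟨δ, hδ, hδO⟩ := Dspace.exists_forall_mem_of_abs_le hO
  obtain ⟨K, hK7, hK⟩ : ∃ K : ℕ, 7 / (K : ℝ) ≤ δ ∧ 8 / ε ≤ K ∧ 0 < K := by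
    obtain ⟨K, hK⟩ := exists_nat_ge (max (7 / δ) (max (8 / ε) 1))
    have a1 := (le_max_left _ _).trans hK
    have a2 := (le_max_right _ _).trans hK
    have a3 := (le_max_right _ _).trans a2
    have a4 : (0:ℝ) < K := by linarith
    refine ⟨K, ?_, (le_max_left _ _).trans a2, by exact_mod_cast a4⟩
    rw [div_le_iff₀ a4]
    rw [div_le_iff₀ hδ] at a1
    linarith
  obtain ⟨hK8, hK0⟩ := hK
  have hK' : (0:ℝ) < K := by exact_mod_cast hK0
  have hε4 : 0 < ε / 4 := by positivity
  filter_upwards [tendsto_nat_div_atTop.eventually (eventually_le_log_blockWays p.2.1 hK0 hε4),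
    tendsto_nat_div_atTop.eventually (eventually_le_log_blockWays p.2.2.1 hK0 hε4),
    eventually_ge_atTop (K ^ 2), eventually_ge_atTop (K + 1),
    eventually_ge_atTop (K * (K + 1))] with n h1 h2 h3 h4 h5
  set m := n / (K + 1) with hm
  have hcard := blockWays_mul_le_card hPi hK0 h3 h4 (p := p) (O := O)
    (fun q hq => hδO q fun x hx => ⟨((hq x hx).1).trans hK7, ((hq x hx).2).trans hK7⟩)
  have hw1 : (0:ℝ) < blockWays p.1.1 K m := by exact_mod_cast blockWays_pos p.2.1 hK0 m
  have hw2 : (0:ℝ) < blockWays p.1.2 K m := by exact_mod_cast blockWays_pos p.2.2.1 hK0 m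
  refine le_trans ?_ (show ((blockWays p.1.1 K m * blockWays p.1.2 K m : ℕ) : ℝ) ≤ _ by
    exact_mod_cast hcard)
  push_cast
  rw [← Real.le_log_iff_exp_le (by positivity), Real.log_mul hw1.ne' hw2.ne']
  refine le_trans ?_ (add_le_add h1 h2)
  have hn1 : (m : ℝ) * (K + 1) ≤ n := by exact_mod_cast Nat.div_mul_le_self n (K + 1)
  have hn2 : (n : ℝ) ≤ (m + 1) * (K + 1) := by
    have : n < (K + 1) * (m + 1) := Nat.lt_mul_div_succ n (Nat.succ_pos K)
    have : (n : ℝ) < (K + 1) * (m + 1) := by exact_mod_cast this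
    linarith
  have hmK : (K : ℝ) ≤ m := by
    have : K ≤ m := (Nat.le_div_iff_mul_le (Nat.succ_pos K)).2 h5
    exact_mod_cast this
  have g1 := densEntropy_nonneg p.2.1
  have g2 := densEntropy_nonneg p.2.2.1
  have g3 := densEntropy_le_log_two p.2.1
  have g4 := densEntropy_le_log_two p.2.2.1
  have g5 := Real.log_two_lt_d9
  set S := densEntropy p.1.1 + densEntropy p.1.2 with hS
  have hS2 : S ≤ 2 := by linarith
  have hS0 : 0 ≤ S := by linarith
  rw [div_le_iff₀ hε] at hK8
  have k1 : (n : ℝ) * S ≤ (m + 1) * (K + 1) * S := by gcongr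
  have k2 : ((m : ℝ) + K + 1) * S ≤ (m + K + 1) * 2 := by gcongr
  have k3 : (m : ℝ) * (K + 1) * ε ≤ n * ε := by gcongr
  have k4 : (m : ℝ) * 8 ≤ m * (K * ε) := by gcongr
  have hm1 : (1:ℝ) ≤ m := le_trans (by exact_mod_cast hK0) hmK
  have k5 : 0 ≤ (m : ℝ) * ε := by positivity
  nlinarith

end Counting

section Assembly

open scoped Topology

/-- Total weight of the `321`-avoiding permutations whose pair of measures lies in `S`. -/
def mallowsWeight (β : ℝ) (Pi : ∀ n : ℕ, Equiv.Perm (Fin n) → Dspace) (n : ℕ)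
    (S : Set Dspace) : ℝ :=
  ∑ σ ∈ Finset.univ.filter (fun σ : Equiv.Perm (Fin n) => Avoids321 σ ∧ Pi n σ ∈ S),
    Real.exp (β / n * invCount σ)

lemma mallowsWeight_univ (β : ℝ) (Pi : ∀ n : ℕ, Equiv.Perm (Fin n) → Dspace) (n : ℕ) :
    mallowsWeight β Pi n univ = Z321 β n := by
  simp [mallowsWeight, Z321]

lemma Z321_pos (β : ℝ) (n : ℕ) : 0 < Z321 β n := by
  refine Finset.sum_pos (fun _ _ => Real.exp_pos _) ⟨1, ?_⟩
  rw [Finset.mem_filter]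
  refine ⟨Finset.mem_univ _, ?_⟩
  rintro ⟨i, j, k, hij, -, hji, -⟩
  exact lt_asymm hij hji

lemma probMallows321_eq (β : ℝ) (Pi : ∀ n : ℕ, Equiv.Perm (Fin n) → Dspace) (n : ℕ)
    (S : Set Dspace) :
    probMallows321 β Pi n S = ENNReal.ofReal (mallowsWeight β Pi n S / Z321 β n) := by
  rw [probMallows321, ← ENNReal.ofReal_sum_of_nonneg fun _ _ => (Real.exp_pos _).le,
    ENNReal.ofReal_div_of_pos (Z321_pos β n)]
  rfl

lemma lowerSemicontinuous_A321 (β : ℝ) : LowerSemicontinuous (A321 β) := by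
  intro p y hy
  obtain ⟨Ψ, hΨ, hle, hp, -⟩ := exists_continuous_minorant β p (ε := (A321 β p - y) / 2)
    (by linarith)
  filter_upwards [hΨ.continuousAt.eventually_const_lt
    (show y - 2 * Real.log 2 < Ψ p by linarith)] with q hq
  linarith [hle q]

lemma bddBelow_range_A321 (β : ℝ) (p : Dspace) : BddBelow (range (A321 β)) := by
  obtain ⟨Ψ, hΨ, hle, -⟩ := exists_continuous_minorant β p one_pos
  obtain ⟨c, hc⟩ := (isCompact_range hΨ).bddBelow
  refine ⟨c + 2 * Real.log 2, ?_⟩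
  rintro _ ⟨q, rfl⟩
  linarith [hle q, hc (mem_range_self q)]

variable {Pi : ∀ n : ℕ, Equiv.Perm (Fin n) → Dspace}

lemma exists_mallowsWeight_le
    (hPi : ∀ n : ℕ, 1 ≤ n → ∀ σ : Equiv.Perm (Fin n), Avoids321 σ →
      ((Pi n σ).1.1 : Measure ℝ) = pi1 σ ∧ ((Pi n σ).1.2 : Measure ℝ) = pi2 σ)
    (β : ℝ) {F : Set Dspace} (hF : IsClosed F) {b : ℝ}
    (hb : ∀ p ∈ F, b < A321 β p - 2 * Real.log 2) :
    ∃ M : ℝ, 0 < M ∧ ∀ n : ℕ, 0 < n → mallowsWeight β Pi n F ≤ M * Real.exp (-(n * b)) := by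
  have hex : ∀ p : F, ∃ Ψ : Dspace → ℝ, Continuous Ψ ∧ b < Ψ p ∧
      ∀ n : ℕ, 0 < n → ∑ σ ∈ Finset.univ.filter (fun σ : Equiv.Perm (Fin n) => Avoids321 σ),
        Real.exp (β / n * invCount σ + n * Ψ (Pi n σ)) ≤ 1 := by
    intro p
    have hp := hb p p.2
    obtain ⟨Ψ, hΨ, -, hp', h⟩ := exists_continuous_minorant β p
      (ε := (A321 β p - 2 * Real.log 2 - b) / 2) (by linarith)
    exact ⟨Ψ, hΨ, by linarith, fun n hn => h n hn (Pi n) (hPi n hn)⟩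
  choose Ψ hΨ hΨb hsum using hex
  obtain ⟨t, ht⟩ := hF.isCompact.elim_finite_subcover (fun p : F => {q | b < Ψ p q})
    (fun p => isOpen_lt continuous_const (hΨ p))
    (fun p hp => mem_iUnion.2 ⟨⟨p, hp⟩, hΨb ⟨p, hp⟩⟩)
  refine ⟨t.card + 1, by positivity, fun n hn => ?_⟩
  have hn' : (0:ℝ) < n := by exact_mod_cast hn
  calc mallowsWeight β Pi n F
      ≤ ∑ σ ∈ Finset.univ.filter (fun σ : Equiv.Perm (Fin n) => Avoids321 σ ∧ Pi n σ ∈ F),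
        ∑ p ∈ t, Real.exp (β / n * invCount σ + n * Ψ p (Pi n σ)) * Real.exp (-(n * b)) := by
        refine Finset.sum_le_sum fun σ hσ => ?_
        obtain ⟨p, hp, hpσ⟩ := mem_iUnion₂.1 (ht (Finset.mem_filter.1 hσ).2.2)
        have hpσ' : b < Ψ p (Pi n σ) := hpσ
        refine le_trans ?_ (Finset.single_le_sum (fun q _ => by positivity) hp)
        rw [← Real.exp_add]
        apply Real.exp_le_exp.2
        have := mul_le_mul_of_nonneg_left hpσ'.le hn'.le
        linarith
    _ ≤ ∑ σ ∈ Finset.univ.filter (fun σ : Equiv.Perm (Fin n) => Avoids321 σ),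
        ∑ p ∈ t, Real.exp (β / n * invCount σ + n * Ψ p (Pi n σ)) * Real.exp (-(n * b)) :=
        Finset.sum_le_sum_of_subset_of_nonneg
          (fun σ hσ => Finset.mem_filter.2 ⟨Finset.mem_univ _, (Finset.mem_filter.1 hσ).2.1⟩)
          fun σ _ _ => by positivity
    _ = ∑ p ∈ t, (∑ σ ∈ Finset.univ.filter (fun σ : Equiv.Perm (Fin n) => Avoids321 σ),
        Real.exp (β / n * invCount σ + n * Ψ p (Pi n σ))) * Real.exp (-(n * b)) := by
        rw [Finset.sum_comm]
        simp_rw [Finset.sum_mul]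
    _ ≤ ∑ p ∈ t, 1 * Real.exp (-(n * b)) :=
        Finset.sum_le_sum fun p _ =>
          mul_le_mul_of_nonneg_right (hsum p n hn) (Real.exp_pos _).le
    _ = t.card * Real.exp (-(n * b)) := by simp
    _ ≤ _ := by gcongr; simp

lemma eventually_exp_le_mallowsWeight
    (hPi : ∀ n : ℕ, 1 ≤ n → ∀ σ : Equiv.Perm (Fin n), Avoids321 σ →
      ((Pi n σ).1.1 : Measure ℝ) = pi1 σ ∧ ((Pi n σ).1.2 : Measure ℝ) = pi2 σ)
    (β : ℝ) {p : Dspace} {O : Set Dspace} (hO : O ∈ 𝓝 p) {ε : ℝ} (hε : 0 < ε) :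
    ∀ᶠ n : ℕ in atTop, Real.exp (-(n * (A321 β p - 2 * Real.log 2 + ε))) ≤
      mallowsWeight β Pi n O := by
  have hO' : O ∩ {q | β * momentDiff p - ε / 2 < β * momentDiff q} ∈ 𝓝 p :=
    inter_mem hO ((isOpen_lt continuous_const
      (continuous_const.mul continuous_momentDiff)).mem_nhds (by simp [hε]))
  filter_upwards [eventually_exp_le_card hPi hO' (half_pos hε), eventually_gt_atTop 0] with n h hn
  have hn' : (0:ℝ) < n := by exact_mod_cast hn
  set T := Finset.univ.filter fun σ : Equiv.Perm (Fin n) => Avoids321 σ ∧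
    Pi n σ ∈ O ∩ {q | β * momentDiff p - ε / 2 < β * momentDiff q} with hT
  calc _ = Real.exp (n * (densEntropy p.1.1 + densEntropy p.1.2 - ε / 2)) *
        Real.exp (n * (β * momentDiff p - ε / 2)) := by
        rw [← Real.exp_add, A321_eq]
        congr 1
        ring
    _ ≤ T.card * Real.exp (n * (β * momentDiff p - ε / 2)) :=
        mul_le_mul_of_nonneg_right (h.trans (le_of_eq (by rw [hT]; congr!)))
          (Real.exp_pos _).le
    _ = ∑ σ ∈ T, Real.exp (n * (β * momentDiff p - ε / 2)) := by
        rw [Finset.sum_const, nsmul_eq_mul]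
    _ ≤ ∑ σ ∈ T, Real.exp (β / n * invCount σ) := by
        refine Finset.sum_le_sum fun σ hσ => Real.exp_le_exp.2 ?_
        obtain ⟨h1, -, h2⟩ := (Finset.mem_filter.1 hσ).2
        have h2' : β * momentDiff p - ε / 2 < β * momentDiff (Pi n σ) := h2
        obtain ⟨e1, e2⟩ := hPi n hn σ h1
        rw [momentDiff_of_avoids321 hn h1 e1 e2] at h2'
        refine (mul_le_mul_of_nonneg_left h2'.le hn'.le).trans (le_of_eq ?_)
        field_simp
    _ ≤ mallowsWeight β Pi n O :=
        Finset.sum_le_sum_of_subset_of_nonneg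
          (fun σ hσ => Finset.mem_filter.2 ⟨Finset.mem_univ _, (Finset.mem_filter.1 hσ).2.1,
            (Finset.mem_filter.1 hσ).2.2.1⟩)
          fun σ _ _ => (Real.exp_pos _).le

lemma inv_mul_log_ofReal_exp {n : ℕ} (hn : 0 < n) (z : ℝ) :
    (((n : ℝ)⁻¹ : ℝ) : EReal) * ENNReal.log (ENNReal.ofReal (Real.exp (n * z))) = z := by
  have hn' : (n:ℝ) ≠ 0 := by exact_mod_cast hn.ne'
  rw [ENNReal.log_ofReal_of_pos (Real.exp_pos _), Real.log_exp, ← EReal.coe_mul,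
    inv_mul_cancel_left₀ hn']

lemma inv_mul_log_mono {x y : ENNReal} (h : x ≤ y) (n : ℕ) :
    (((n : ℝ)⁻¹ : ℝ) : EReal) * ENNReal.log x ≤ (((n : ℝ)⁻¹ : ℝ) : EReal) * ENNReal.log y :=
  mul_le_mul_of_nonneg_left (ENNReal.log_monotone h) (EReal.coe_nonneg.2 (by positivity))

lemma eventually_le_exp_mul (M : ℝ) {ε : ℝ} (hε : 0 < ε) :
    ∀ᶠ n : ℕ in atTop, M ≤ Real.exp (n * ε) :=
  (Real.tendsto_exp_atTop.comp
    (tendsto_natCast_atTop_atTop.atTop_mul_const hε)).eventually_ge_atTop M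

lemma eventually_probMallows321_le
    (hPi : ∀ n : ℕ, 1 ≤ n → ∀ σ : Equiv.Perm (Fin n), Avoids321 σ →
      ((Pi n σ).1.1 : Measure ℝ) = pi1 σ ∧ ((Pi n σ).1.2 : Measure ℝ) = pi2 σ)
    (β : ℝ) {F : Set Dspace} (hF : IsClosed F) {z ε : ℝ} (hε : 0 < ε)
    (hz : ∀ p ∈ F, -z < A321 β p - ⨅ q, A321 β q) :
    ∀ᶠ n : ℕ in atTop,
      probMallows321 β Pi n F ≤ ENNReal.ofReal (Real.exp (n * (z + ε))) := by
  have : Nonempty Dspace := ⟨Pi 1 1⟩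
  set c := ⨅ q, A321 β q
  obtain ⟨M, hM, hW⟩ := exists_mallowsWeight_le hPi β hF (b := c - 2 * Real.log 2 - z)
    (fun p hp => by linarith [hz p hp])
  obtain ⟨p, hp⟩ := exists_lt_of_ciInf_lt (show ⨅ q, A321 β q < c + ε / 4 by
    change c < _; linarith)
  filter_upwards [eventually_exp_le_mallowsWeight hPi β (univ_mem : univ ∈ 𝓝 p)
    (show 0 < ε / 4 by positivity), eventually_le_exp_mul M (show 0 < ε / 2 by positivity),
    eventually_gt_atTop 0] with n h1 h2 hn
  have hn' : (0:ℝ) < n := by exact_mod_cast hn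
  rw [mallowsWeight_univ] at h1
  rw [probMallows321_eq]
  apply ENNReal.ofReal_le_ofReal
  rw [div_le_iff₀ (Z321_pos β n)]
  calc _ ≤ M * Real.exp (-(n * (c - 2 * Real.log 2 - z))) := hW n hn
    _ ≤ Real.exp (n * (ε / 2)) * Real.exp (-(n * (c - 2 * Real.log 2 - z))) := by gcongr
    _ = Real.exp (n * (z + ε)) * Real.exp (-(n * (c + ε / 4 - 2 * Real.log 2 + ε / 4))) := by
        rw [← Real.exp_add, ← Real.exp_add]
        congr 1
        ring
    _ ≤ Real.exp (n * (z + ε)) * Real.exp (-(n * (A321 β p - 2 * Real.log 2 + ε / 4))) := by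
        gcongr
    _ ≤ _ := by gcongr

lemma eventually_le_probMallows321
    (hPi : ∀ n : ℕ, 1 ≤ n → ∀ σ : Equiv.Perm (Fin n), Avoids321 σ →
      ((Pi n σ).1.1 : Measure ℝ) = pi1 σ ∧ ((Pi n σ).1.2 : Measure ℝ) = pi2 σ)
    (β : ℝ) {p : Dspace} {O : Set Dspace} (hO : O ∈ 𝓝 p) {ε : ℝ} (hε : 0 < ε) :
    ∀ᶠ n : ℕ in atTop,
      ENNReal.ofReal (Real.exp (n * (-(A321 β p - ⨅ q, A321 β q) - ε))) ≤
        probMallows321 β Pi n O := by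
  set c := ⨅ q, A321 β q
  have hc : ∀ q, c ≤ A321 β q := fun q => ciInf_le (bddBelow_range_A321 β p) q
  obtain ⟨M, hM, hW⟩ := exists_mallowsWeight_le hPi β isClosed_univ
    (b := c - 2 * Real.log 2 - ε / 4) (fun q _ => by linarith [hc q])
  filter_upwards [eventually_exp_le_mallowsWeight hPi β hO (show 0 < ε / 4 by positivity),
    eventually_le_exp_mul M (show 0 < ε / 2 by positivity),
    eventually_gt_atTop 0] with n h1 h2 hn
  have hZ := hW n hn
  rw [mallowsWeight_univ] at hZ
  rw [probMallows321_eq]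
  apply ENNReal.ofReal_le_ofReal
  rw [le_div_iff₀ (Z321_pos β n)]
  calc _ ≤ Real.exp (n * (-(A321 β p - c) - ε)) *
        (M * Real.exp (-(n * (c - 2 * Real.log 2 - ε / 4)))) := by gcongr
    _ ≤ Real.exp (n * (-(A321 β p - c) - ε)) *
        (Real.exp (n * (ε / 2)) * Real.exp (-(n * (c - 2 * Real.log 2 - ε / 4)))) := by gcongr
    _ = Real.exp (-(n * (A321 β p - 2 * Real.log 2 + ε / 4))) := by
        rw [← Real.exp_add, ← Real.exp_add]
        congr 1
        ring
    _ ≤ _ := h1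

end Assembly

/-- Large deviation principle for the pairs of RLM occupation measures of Mallows
random permutations with parameter `e^{β/n}` conditioned to avoid `321`, at speed `n`,
with rate function `(π₁,π₂) ↦ A_β(π₁,π₂) − inf_D A_β`. -/
theorem LDP_Mallows_321 (β : ℝ) (Pi : ∀ n : ℕ, Equiv.Perm (Fin n) → Dspace)
    (hPi : ∀ n : ℕ, 1 ≤ n → ∀ σ : Equiv.Perm (Fin n), Avoids321 σ →
      ((Pi n σ).1.1 : Measure ℝ) = pi1 σ ∧ ((Pi n σ).1.2 : Measure ℝ) = pi2 σ) :
    SatisfiesLDP (probMallows321 β Pi)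
      (fun p => ((A321 β p - ⨅ q : Dspace, A321 β q : ℝ) : EReal)) := by
  refine ⟨?_, ?_, ?_, ?_⟩
  · exact continuous_coe_real_ereal.comp_lowerSemicontinuous
      ((lowerSemicontinuous_A321 β).add lowerSemicontinuous_const)
      (fun x y h => EReal.coe_le_coe_iff.2 h)
  · intro p
    exact EReal.coe_nonneg.2 (sub_nonneg.2 (ciInf_le (bddBelow_range_A321 β p) p))
  · intro F hF
    refine EReal.le_of_forall_lt_iff_le.1 fun z hz => ?_
    obtain ⟨z', h1, h2⟩ := EReal.lt_iff_exists_real_btwn.1 hz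
    have h2' : z' < z := EReal.coe_lt_coe_iff.1 h2
    have hF' : ∀ p ∈ F, -z' < A321 β p - ⨅ q, A321 β q := by
      intro p hp
      have h3 := EReal.neg_lt_comm.1 h1
      have h4 := h3.trans_le (iInf₂_le p hp)
      rw [← EReal.coe_neg] at h4
      exact EReal.coe_lt_coe_iff.1 h4
    refine limsup_le_of_le ?_ ?_
    · isBoundedDefault
    · filter_upwards [eventually_probMallows321_le hPi β hF (sub_pos.2 h2') hF',
        eventually_gt_atTop 0] with n hn hn0
      refine (inv_mul_log_mono hn n).trans ?_
      rw [inv_mul_log_ofReal_exp hn0, add_sub_cancel]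
  · intro O hO
    refine EReal.neg_le_of_neg_le (le_iInf₂ fun p hp => EReal.neg_le_of_neg_le ?_)
    refine EReal.ge_of_forall_gt_iff_ge.1 fun z hz => ?_
    rw [← EReal.coe_neg] at hz
    have hz' := EReal.coe_lt_coe_iff.1 hz
    refine le_liminf_of_le ?_ ?_
    · isBoundedDefault
    · filter_upwards [eventually_le_probMallows321 hPi β (hO.mem_nhds hp) (sub_pos.2 hz'),
        eventually_gt_atTop 0] with n hn hn0
      refine le_trans ?_ (inv_mul_log_mono hn n)
      rw [inv_mul_log_ofReal_exp hn0, sub_sub_cancel]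

end
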